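/- Let n ≥ 1, let V ⊆ ℝ^n be an n-dimensional simplex all of whose vertices lie in ℚ^n, let f₁,…,f_k : ℝ^n → ℝ be affine (degree ≤ 1) polynomials with rational coefficients, each positive on the interior of V, let m be a positive integer, let E : ℂ × ℂ^n → ℂ be analytic on an open set containing ℂ × V, and let 𝒱 ⊆ ℂ be a ℚ-linear subspace of ℂ. Assume there is a polynomial P ∈ ℂ[x₁,…,x_n], all of whose coefficients lie in 𝒱, with E(−m, x) = P(x) for all x ∈ V. Then there exists F : ℂ → ℂ, meromorphic on all of ℂ, with F(s) = ∫_V (f₁(x)⋯f_k(x))^s · E(s,x) dx for every s with Re(s) > 0, such that the limit lim_{s→−m} (s+m)^n · F(s) exists and lies in 𝒱. -/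

import Mathlib

open Complex MeasureTheory Filter

/-- Lebesgue measure on the unit cube `(0, 1]^n`. -/
noncomputable def unitCubeMeasure (n : ℕ) : Measure (Fin n → ℝ) :=
  Measure.pi fun _ => volume.restrict (Set.Ioc (0 : ℝ) 1)

/-- `G` is complex analytic at every point of `ℂ × [0, 1]^n`. -/
def AnalyticOnUnitCube {n : ℕ} (G : ℂ × (Fin n → ℂ) → ℂ) : Prop :=
  ∀ s : ℂ, ∀ t ∈ Set.Icc (0 : Fin n → ℝ) 1, AnalyticAt ℂ G (s, fun i => (t i : ℂ))

/-- The integrand `∏ᵢ tᵢ ^ (aᵢ s + bᵢ) * G (s, t)`. -/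
noncomputable def cubeIntegrand {n : ℕ} (a b : Fin n → ℕ) (G : ℂ × (Fin n → ℂ) → ℂ) (s : ℂ)
    (t : Fin n → ℝ) : ℂ :=
  (∏ i, (t i : ℂ) ^ ((a i : ℂ) * s + b i)) * G (s, fun i => (t i : ℂ))

/-- The integral of `∏ᵢ tᵢ ^ (aᵢ s + bᵢ) * G (s, t)` over the unit cube. -/
noncomputable def cubeIntegral {n : ℕ} (a b : Fin n → ℕ) (G : ℂ × (Fin n → ℂ) → ℂ) (s : ℂ) : ℂ :=
  ∫ t, cubeIntegrand a b G s t ∂unitCubeMeasure n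

section CubeIntegral

variable {n : ℕ} {a b : Fin n → ℕ} {G : ℂ × (Fin n → ℂ) → ℂ}

lemma unitCubeMeasure_eq_restrict (n : ℕ) :
    unitCubeMeasure n = volume.restrict (Set.univ.pi fun _ : Fin n => Set.Ioc (0 : ℝ) 1) := by
  rw [unitCubeMeasure, volume_pi, Measure.restrict_pi_pi]

lemma measurableSet_pi_Ioc (n : ℕ) :
    MeasurableSet (Set.univ.pi fun _ : Fin n => Set.Ioc (0 : ℝ) 1) :=
  MeasurableSet.univ_pi fun _ => measurableSet_Ioc

lemma ae_unitCubeMeasure (n : ℕ) :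
    ∀ᵐ t ∂unitCubeMeasure n, ∀ i, t i ∈ Set.Ioc (0 : ℝ) 1 := by
  rw [unitCubeMeasure_eq_restrict]
  filter_upwards [ae_restrict_mem (measurableSet_pi_Ioc n)] with t ht i using ht i trivial

instance (n : ℕ) : IsProbabilityMeasure (unitCubeMeasure n) := by
  have : IsProbabilityMeasure (volume.restrict (Set.Ioc (0 : ℝ) 1)) := ⟨by simp⟩
  unfold unitCubeMeasure
  infer_instance

lemma mem_Icc_of_forall_mem_Ioc {t : Fin n → ℝ} (ht : ∀ i, t i ∈ Set.Ioc (0 : ℝ) 1) :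
    t ∈ Set.Icc (0 : Fin n → ℝ) 1 :=
  ⟨fun i => (ht i).1.le, fun i => (ht i).2⟩

lemma AnalyticOnUnitCube.continuousOn (hG : AnalyticOnUnitCube G) :
    ContinuousOn (fun p : ℂ × (Fin n → ℝ) => G (p.1, fun i => (p.2 i : ℂ)))
      (Set.univ ×ˢ Set.Icc 0 1) := by
  rintro ⟨s, t⟩ ⟨-, ht⟩
  have h : Continuous fun p : ℂ × (Fin n → ℝ) => (p.1, fun i => (p.2 i : ℂ)) := by fun_prop
  exact (ContinuousAt.comp (f := fun p : ℂ × (Fin n → ℝ) => (p.1, fun i => (p.2 i : ℂ)))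
    (x := (s, t)) (hG s t ht).continuousAt h.continuousAt).continuousWithinAt

lemma AnalyticOnUnitCube.differentiableAt_left (hG : AnalyticOnUnitCube G) {t : Fin n → ℝ}
    (ht : t ∈ Set.Icc (0 : Fin n → ℝ) 1) (s : ℂ) :
    DifferentiableAt ℂ (fun s => G (s, fun i => (t i : ℂ))) s :=
  DifferentiableAt.comp (g := G) (f := fun s : ℂ => (s, fun i => (t i : ℂ))) s
    (hG s t ht).differentiableAt (by fun_prop)

lemma differentiableAt_cubeIntegrand (hG : AnalyticOnUnitCube G) {t : Fin n → ℝ}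
    (ht : ∀ i, t i ∈ Set.Ioc (0 : ℝ) 1) (s : ℂ) :
    DifferentiableAt ℂ (fun s => cubeIntegrand a b G s t) s := by
  refine DifferentiableAt.mul ?_ (hG.differentiableAt_left (mem_Icc_of_forall_mem_Ioc ht) s)
  refine DifferentiableAt.fun_finsetProd fun i _ => ?_
  refine DifferentiableAt.const_cpow (by fun_prop) (Or.inl ?_)
  exact_mod_cast (ht i).1.ne'

lemma aestronglyMeasurable_cubeIntegrand (hG : AnalyticOnUnitCube G) (s : ℂ) :
    AEStronglyMeasurable (cubeIntegrand a b G s) (unitCubeMeasure n) := by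
  rw [unitCubeMeasure_eq_restrict]
  refine ContinuousOn.aestronglyMeasurable ?_ (measurableSet_pi_Ioc n)
  refine ContinuousOn.mul ?_ ?_
  · refine continuousOn_finsetProd _ fun i _ => ?_
    intro t ht
    refine ContinuousAt.continuousWithinAt ?_
    refine ContinuousAt.cpow (Continuous.continuousAt (by fun_prop)) continuousAt_const ?_
    exact Or.inl (by simpa using (ht i trivial).1)
  · exact hG.continuousOn.comp (f := fun t : Fin n → ℝ => (s, t)) (by fun_prop)
      fun t ht => ⟨trivial, mem_Icc_of_forall_mem_Ioc fun i => ht i trivial⟩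

lemma integrable_prod_rpow {c : Fin n → ℝ} (hc : ∀ i, -1 < c i) :
    Integrable (fun t : Fin n → ℝ => ∏ i, t i ^ c i) (unitCubeMeasure n) := by
  refine Integrable.fintype_prod (f := fun i (x : ℝ) => x ^ c i) fun i => ?_
  have := intervalIntegral.intervalIntegrable_rpow' (a := 0) (b := 1) (hc i)
  rwa [intervalIntegrable_iff_integrableOn_Ioc_of_le zero_le_one] at this

/-- Locally uniformly in `s`, the integrand has an integrable majorant. -/
lemma exists_bound_cubeIntegrand (hG : AnalyticOnUnitCube G) {s₀ : ℂ}
    (hs : ∀ i, -1 < a i * s₀.re + b i) :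
    ∃ B : (Fin n → ℝ) → ℝ, Integrable B (unitCubeMeasure n) ∧
      ∀ᶠ s in nhds s₀, ∀ t : Fin n → ℝ, (∀ i, t i ∈ Set.Ioc (0 : ℝ) 1) →
        ‖cubeIntegrand a b G s t‖ ≤ B t := by
  have hK : IsCompact (Metric.closedBall s₀ 1 ×ˢ Set.Icc (0 : Fin n → ℝ) 1) :=
    (isCompact_closedBall s₀ 1).prod isCompact_Icc
  obtain ⟨C, hC⟩ := hK.exists_bound_of_continuousOn
    (hG.continuousOn.mono (Set.prod_mono_left (Set.subset_univ _)))
  set c : Fin n → ℝ := fun i => (a i * s₀.re + b i - 1) / 2 with hcdef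
  have hc : ∀ i, -1 < c i := fun i => by have := hs i; simp only [hcdef]; linarith
  refine ⟨fun t => (∏ i, t i ^ c i) * C, (integrable_prod_rpow hc).mul_const C, ?_⟩
  have h1 : ∀ᶠ s : ℂ in nhds s₀, ∀ i, c i < a i * s.re + b i := by
    rw [eventually_all]
    intro i
    have hcont : ContinuousAt (fun s : ℂ => (a i : ℝ) * s.re + b i) s₀ := by fun_prop
    exact hcont.eventually_const_lt (by have := hs i; simp only [hcdef]; linarith)
  filter_upwards [h1, Metric.closedBall_mem_nhds s₀ one_pos] with s hs1 hs2 t ht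
  rw [cubeIntegrand, norm_mul, norm_prod]
  have hmem := mem_Icc_of_forall_mem_Ioc ht
  refine mul_le_mul ?_ (hC (s, t) ⟨hs2, hmem⟩) (norm_nonneg _)
    (Finset.prod_nonneg fun i _ => Real.rpow_nonneg (ht i).1.le _)
  refine Finset.prod_le_prod (fun i _ => norm_nonneg _) fun i _ => ?_
  rw [norm_cpow_eq_rpow_re_of_pos (ht i).1]
  refine Real.rpow_le_rpow_of_exponent_ge (ht i).1 (ht i).2 ?_
  simpa using (hs1 i).le

lemma integrable_cubeIntegrand (hG : AnalyticOnUnitCube G) {s : ℂ}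
    (hs : ∀ i, -1 < a i * s.re + b i) :
    Integrable (cubeIntegrand a b G s) (unitCubeMeasure n) := by
  obtain ⟨B, hB, h⟩ := exists_bound_cubeIntegrand hG hs
  refine hB.mono' (aestronglyMeasurable_cubeIntegrand hG s) ?_
  filter_upwards [ae_unitCubeMeasure n] with t ht using h.self_of_nhds t ht

end CubeIntegral

/-- An integral of a dominated holomorphic family is holomorphic. -/
lemma differentiableAt_integral_of_dominated {α : Type*} [MeasurableSpace α] {μ : Measure α}
    {F : ℂ → α → ℂ} {B : α → ℝ} {s₀ : ℂ} (hF : ∀ s, AEStronglyMeasurable (F s) μ)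
    (hd : ∀ᵐ x ∂μ, ∀ s, DifferentiableAt ℂ (fun s => F s x) s) (hB : Integrable B μ)
    (hb : ∃ V ∈ nhds s₀, ∀ᵐ x ∂μ, ∀ s ∈ V, ‖F s x‖ ≤ B x) :
    DifferentiableAt ℂ (fun s => ∫ x, F s x ∂μ) s₀ := by
  obtain ⟨V, hV, hVB⟩ := hb
  obtain ⟨r, hr, hrV⟩ := Metric.mem_nhds_iff.1 hV
  have hmeas : AEStronglyMeasurable (fun x => deriv (fun s => F s x) s₀) μ := by
    have hlim : Tendsto (fun k : ℕ => ((k : ℂ) + 1)⁻¹) atTop (nhdsWithin 0 {0}ᶜ) := by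
      refine tendsto_nhdsWithin_iff.2 ⟨?_, Eventually.of_forall fun k => ?_⟩
      · simpa using tendsto_one_div_add_atTop_nhds_zero_nat (𝕜 := ℂ)
      · simpa using Nat.cast_add_one_ne_zero k
    refine aestronglyMeasurable_of_tendsto_ae atTop
      (f := fun (k : ℕ) x => (((k : ℂ) + 1)⁻¹)⁻¹ • (F (s₀ + ((k : ℂ) + 1)⁻¹) x - F s₀ x))
      (fun k => ((hF (s₀ + ((k : ℂ) + 1)⁻¹)).sub (hF s₀)).const_smul (((k : ℂ) + 1)⁻¹)⁻¹) ?_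
    filter_upwards [hd] with x hx
    exact (hx s₀).hasDerivAt.tendsto_slope_zero.comp hlim
  refine (hasDerivAt_integral_of_dominated_loc_of_deriv_le
    (F' := fun s x => deriv (fun s => F s x) s) (bound := fun x => B x / (r / 2))
    (s := Metric.ball s₀ (r / 2)) (Metric.ball_mem_nhds s₀ (half_pos hr))
    (Eventually.of_forall hF) ?_ hmeas ?_ (hB.div_const _) ?_).2.differentiableAt
  · refine hB.mono' (hF s₀) ?_
    filter_upwards [hVB] with x hx using hx s₀ (mem_of_mem_nhds hV)
  · filter_upwards [hd, hVB] with x hx hxB s hs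
    refine norm_deriv_le_of_forall_mem_sphere_norm_le (half_pos hr)
      (f := fun s => F s x) ?_ fun z hz => hxB z (hrV ?_)
    · exact (Differentiable.diffContOnCl fun s => hx s)
    · rw [Metric.mem_ball] at hs ⊢
      rw [Metric.mem_sphere] at hz
      linarith [dist_triangle z s s₀]
  · filter_upwards [hd] with x hx s _ using (hx s).hasDerivAt

lemma differentiableAt_cubeIntegral {n : ℕ} {a b : Fin n → ℕ} {G : ℂ × (Fin n → ℂ) → ℂ}
    (hG : AnalyticOnUnitCube G) {s : ℂ} (hs : ∀ i, -1 < a i * s.re + b i) :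
    DifferentiableAt ℂ (cubeIntegral a b G) s := by
  obtain ⟨B, hB, h⟩ := exists_bound_cubeIntegrand hG hs
  refine differentiableAt_integral_of_dominated (B := B)
    (fun s => aestronglyMeasurable_cubeIntegrand hG s) ?_ hB ⟨_, h, ?_⟩
  · filter_upwards [ae_unitCubeMeasure n] with t ht s using differentiableAt_cubeIntegrand hG ht s
  · filter_upwards [ae_unitCubeMeasure n] with t ht s hs using hs t ht

/-- The restriction of `G` to the face `tᵢ = 1` of the cube. -/
def cubeFace {n : ℕ} (i : Fin (n + 1)) (G : ℂ × (Fin (n + 1) → ℂ) → ℂ) :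
    ℂ × (Fin n → ℂ) → ℂ :=
  fun p => G (p.1, i.insertNth 1 p.2)

/-- The partial derivative of `G` in the direction `tᵢ`. -/
noncomputable def cubePartial {n : ℕ} (i : Fin n) (G : ℂ × (Fin n → ℂ) → ℂ) :
    ℂ × (Fin n → ℂ) → ℂ :=
  fun p => fderiv ℂ G p (0, Pi.single i 1)

lemma Fin.insertNth_ofReal {n : ℕ} (i : Fin (n + 1)) (x : ℝ) (y : Fin n → ℝ) :
    (fun j => ((i.insertNth x y : Fin (n + 1) → ℝ) j : ℂ)) =
      (i.insertNth (x : ℂ) (fun j => (y j : ℂ)) : Fin (n + 1) → ℂ) := by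
  ext k
  refine Fin.succAboveCases i ?_ (fun j => ?_) k <;> simp

lemma Fin.insertNth_mem_Icc_zero_one {n : ℕ} (i : Fin (n + 1)) {x : ℝ} {y : Fin n → ℝ}
    (hx : x ∈ Set.Icc (0 : ℝ) 1) (hy : y ∈ Set.Icc (0 : Fin n → ℝ) 1) :
    (i.insertNth x y : Fin (n + 1) → ℝ) ∈ Set.Icc (0 : Fin (n + 1) → ℝ) 1 := by
  constructor <;> intro k <;> refine Fin.succAboveCases i ?_ (fun j => ?_) k
  · simpa using hx.1
  · simpa using hy.1 j
  · simpa using hx.2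
  · simpa using hy.2 j

lemma AnalyticOnUnitCube.face {n : ℕ} {G : ℂ × (Fin (n + 1) → ℂ) → ℂ}
    (hG : AnalyticOnUnitCube G) (i : Fin (n + 1)) : AnalyticOnUnitCube (cubeFace i G) := by
  intro s t ht
  have h := hG s (i.insertNth 1 t) (i.insertNth_mem_Icc_zero_one (by simp) ht)
  rw [Fin.insertNth_ofReal, ofReal_one] at h
  refine AnalyticAt.fun_comp (f := fun p : ℂ × (Fin n → ℂ) =>
    (p.1, (i.insertNth 1 p.2 : Fin (n + 1) → ℂ))) (g := G) h ?_
  refine analyticAt_fst.prod (analyticAt_pi_iff.2 fun k => ?_)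
  refine Fin.succAboveCases i ?_ (fun j => ?_) k
  · simpa using analyticAt_const
  · simpa using ((ContinuousLinearMap.proj j : (Fin n → ℂ) →L[ℂ] ℂ).analyticAt _).fun_comp
      analyticAt_snd

lemma AnalyticOnUnitCube.partialDeriv {n : ℕ} {G : ℂ × (Fin n → ℂ) → ℂ}
    (hG : AnalyticOnUnitCube G) (i : Fin n) : AnalyticOnUnitCube (cubePartial i G) :=
  fun s t ht =>
    ((ContinuousLinearMap.apply ℂ ℂ ((0 : ℂ), (Pi.single i 1 : Fin n → ℂ))).analyticAt _).fun_comp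
      (hG s t ht).fderiv

lemma AnalyticOnUnitCube.hasDerivAt_insertNth {n : ℕ} {G : ℂ × (Fin (n + 1) → ℂ) → ℂ}
    (hG : AnalyticOnUnitCube G) (i : Fin (n + 1)) (s : ℂ) {x : ℝ} {y : Fin n → ℝ}
    (hx : x ∈ Set.Icc (0 : ℝ) 1) (hy : y ∈ Set.Icc (0 : Fin n → ℝ) 1) :
    HasDerivAt (fun x : ℝ => G (s, fun j => ((i.insertNth x y : Fin (n + 1) → ℝ) j : ℂ)))
      (cubePartial i G (s, fun j => ((i.insertNth x y : Fin (n + 1) → ℝ) j : ℂ))) x := by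
  have h := (hG s _ (i.insertNth_mem_Icc_zero_one hx hy)).differentiableAt.hasFDerivAt
  simp only [Fin.insertNth_ofReal, cubePartial] at h ⊢
  have hp : HasDerivAt (fun z : ℂ => (s, (i.insertNth z (fun j => (y j : ℂ)) : Fin (n + 1) → ℂ)))
      ((0 : ℂ), (Pi.single i 1 : Fin (n + 1) → ℂ)) (x : ℂ) := by
    refine (hasDerivAt_const _ _).prodMk (hasDerivAt_pi.2 fun k => ?_)
    refine Fin.succAboveCases i ?_ (fun j => ?_) k
    · simpa using hasDerivAt_id' (x : ℂ)
    · simpa using hasDerivAt_const (x : ℂ) _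
  exact (HasFDerivAt.comp_hasDerivAt (x : ℂ) h hp).comp_ofReal

/-- Integration by parts against a power of the variable on the unit interval. -/
lemma integral_cpow_mul_eq {w : ℂ} (hw : -1 < w.re) {g g' : ℝ → ℂ}
    (hg : ∀ x ∈ Set.Icc (0 : ℝ) 1, HasDerivAt g (g' x) x)
    (hg' : ContinuousOn g' (Set.Icc 0 1)) :
    ∫ x in Set.Ioc (0 : ℝ) 1, (x : ℂ) ^ w * g x =
      (w + 1)⁻¹ * (g 1 - ∫ x in Set.Ioc (0 : ℝ) 1, (x : ℂ) ^ (w + 1) * g' x) := by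
  have hw1 : w + 1 ≠ 0 := fun h => by
    have := congrArg re h
    simp at this
    linarith
  have hgc : ContinuousOn g (Set.Icc 0 1) := fun x hx => (hg x hx).continuousAt.continuousWithinAt
  have hre : 0 < (w + 1).re := by simp; linarith
  have hpc : Continuous fun x : ℝ => (x : ℂ) ^ (w + 1) :=
    Complex.continuous_ofReal_cpow_const hre
  have hi1 : IntervalIntegrable (fun x : ℝ => (x : ℂ) ^ w * g x) volume 0 1 := by
    refine (intervalIntegral.intervalIntegrable_cpow' hw).mul_continuousOn ?_
    rwa [Set.uIcc_of_le zero_le_one]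
  have hi2 : IntervalIntegrable (fun x : ℝ => (x : ℂ) ^ (w + 1) * g' x) volume 0 1 := by
    refine ContinuousOn.intervalIntegrable ?_
    rw [Set.uIcc_of_le zero_le_one]
    exact hpc.continuousOn.mul hg'
  have key := intervalIntegral.integral_eq_sub_of_hasDerivAt_of_le (a := 0) (b := 1) zero_le_one
    (f := fun x : ℝ => (x : ℂ) ^ (w + 1) * g x)
    (f' := fun x : ℝ => (w + 1) * ((x : ℂ) ^ w * g x) + (x : ℂ) ^ (w + 1) * g' x)
    (hpc.continuousOn.mul hgc) (fun x hx => ?_) ((hi1.const_mul _).add hi2)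
  · rw [intervalIntegral.integral_add (hi1.const_mul _) hi2,
      intervalIntegral.integral_const_mul, intervalIntegral.integral_of_le zero_le_one,
      intervalIntegral.integral_of_le zero_le_one] at key
    simp only [ofReal_one, one_cpow, one_mul, ofReal_zero, zero_cpow hw1, zero_mul,
      sub_zero] at key
    rw [← key]
    field_simp
    ring
  · have h1 : HasDerivAt (fun x : ℝ => (x : ℂ) ^ (w + 1)) ((w + 1) * (x : ℂ) ^ w) x := by
      have := HasDerivAt.cpow_const (c := w + 1) (hasDerivAt_id (x : ℂ))
        (Or.inl (by simpa using hx.1))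
      simpa using this.comp_ofReal
    exact (h1.mul (hg x ⟨hx.1.le, hx.2.le⟩)).congr_deriv (by ring)

section Fubini

variable {n : ℕ} {a b : Fin (n + 1) → ℕ} {G : ℂ × (Fin (n + 1) → ℂ) → ℂ}

lemma cubeIntegrand_insertNth (i : Fin (n + 1)) (s : ℂ) (x : ℝ) (y : Fin n → ℝ) :
    cubeIntegrand a b G s (i.insertNth x y) =
      (∏ j, (y j : ℂ) ^ ((a (i.succAbove j) : ℂ) * s + b (i.succAbove j))) *
        ((x : ℂ) ^ ((a i : ℂ) * s + b i) *
          G (s, fun j => ((i.insertNth x y : Fin (n + 1) → ℝ) j : ℂ))) := by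
  rw [cubeIntegrand, Fin.prod_univ_succAbove _ i]
  simp only [Fin.insertNth_apply_same, Fin.insertNth_apply_succAbove]
  ring

lemma measurePreserving_insertNth (i : Fin (n + 1)) :
    MeasurePreserving (MeasurableEquiv.piFinSuccAbove (fun _ => ℝ) i).symm
      ((volume.restrict (Set.Ioc (0 : ℝ) 1)).prod (unitCubeMeasure n))
      (unitCubeMeasure (n + 1)) :=
  (measurePreserving_piFinSuccAbove (fun _ => volume.restrict (Set.Ioc (0 : ℝ) 1)) i).symm

instance : IsProbabilityMeasure (volume.restrict (Set.Ioc (0 : ℝ) 1)) := ⟨by simp⟩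

lemma integrable_insertNth (hG : AnalyticOnUnitCube G) (i : Fin (n + 1)) {s : ℂ}
    (hs : ∀ i, -1 < a i * s.re + b i) :
    Integrable (fun p : ℝ × (Fin n → ℝ) => cubeIntegrand a b G s (i.insertNth p.1 p.2))
      ((volume.restrict (Set.Ioc (0 : ℝ) 1)).prod (unitCubeMeasure n)) := by
  exact (measurePreserving_insertNth i).integrable_comp_of_integrable
    (integrable_cubeIntegrand hG hs)

lemma cubeIntegral_eq_integral_integral (hG : AnalyticOnUnitCube G) (i : Fin (n + 1)) {s : ℂ}
    (hs : ∀ i, -1 < a i * s.re + b i) :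
    cubeIntegral a b G s = ∫ y, (∫ x in Set.Ioc (0 : ℝ) 1,
      cubeIntegrand a b G s (i.insertNth x y)) ∂unitCubeMeasure n := by
  rw [cubeIntegral, ← (measurePreserving_insertNth i).integral_comp']
  exact integral_prod_symm _ (integrable_insertNth hG i hs)

/-- Integration by parts in the `i`-th variable of a cube integral. -/
lemma cubeIntegral_eq_face_sub_partial (hG : AnalyticOnUnitCube G) (i : Fin (n + 1)) {s : ℂ}
    (hs : ∀ i, -1 < a i * s.re + b i) :
    cubeIntegral a b G s = ((a i : ℂ) * s + b i + 1)⁻¹ *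
      (cubeIntegral (fun j => a (i.succAbove j)) (fun j => b (i.succAbove j)) (cubeFace i G) s -
        cubeIntegral a (Function.update b i (b i + 1)) (cubePartial i G) s) := by
  have hG' := hG.partialDeriv i
  have hs' : ∀ k, -1 < a k * s.re + (Function.update b i (b i + 1) k : ℕ) := by
    intro k
    rcases eq_or_ne k i with rfl | hk
    · have := hs k
      simp only [Function.update_self, Nat.cast_add, Nat.cast_one]
      linarith
    · simpa [Function.update_of_ne hk] using hs k
  have hint1 := integrable_cubeIntegrand (hG.face i) (a := fun j => a (i.succAbove j))
    (b := fun j => b (i.succAbove j)) (s := s) fun j => hs _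
  have hint2 := (integrable_insertNth hG' i hs').integral_prod_right
  rw [cubeIntegral_eq_integral_integral hG i hs, cubeIntegral_eq_integral_integral hG' i hs',
    cubeIntegral, ← integral_sub hint1 hint2, ← integral_const_mul]
  refine integral_congr_ae ?_
  filter_upwards [ae_unitCubeMeasure n] with y hy
  have hy' := mem_Icc_of_forall_mem_Ioc hy
  have hw : -1 < ((a i : ℂ) * s + b i).re := by simpa using hs i
  simp only [cubeIntegrand_insertNth, integral_const_mul]
  rw [integral_cpow_mul_eq hw (fun x hx => hG.hasDerivAt_insertNth i s hx hy')]
  · simp only [Function.update_self, ne_eq, Fin.succAbove_ne, not_false_eq_true,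
      Function.update_of_ne, cubeIntegrand, cubeFace, Fin.insertNth_ofReal, ofReal_one,
      Nat.cast_add, Nat.cast_one, ← add_assoc]
    ring
  · intro x hx
    exact (hG'.hasDerivAt_insertNth i s hx hy').continuousAt.continuousWithinAt

end Fubini

section LeadingCoefficient

variable {n : ℕ} {a b : Fin n → ℕ} {G : ℂ × (Fin n → ℂ) → ℂ}

lemma AnalyticOnUnitCube.exists_lipschitz_bound (hG : AnalyticOnUnitCube G) (s₀ : ℂ) :
    ∃ C : ℝ, 0 ≤ C ∧ ∀ ε ∈ Set.Icc (0 : ℝ) 1, ∀ t ∈ Set.Icc (0 : Fin n → ℝ) 1,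
      ‖G (s₀ + ε, fun i => (t i : ℂ)) - G (s₀, 0)‖ ≤ C * (ε + ∑ j, t j) := by
  set Λ : (Fin n → ℝ) →L[ℝ] (Fin n → ℂ) :=
    ContinuousLinearMap.pi fun i => ofRealCLM.comp (ContinuousLinearMap.proj i) with hΛ
  have hΛt : ∀ t, Λ t = fun i => (t i : ℂ) := fun t => rfl
  set S : Set (ℂ × (Fin n → ℂ)) := Metric.closedBall s₀ 1 ×ˢ (Λ '' Set.Icc 0 1) with hS
  have hconv : Convex ℝ S :=
    (convex_closedBall s₀ 1).prod ((convex_Icc 0 1).linear_image Λ.toLinearMap)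
  have hcomp : IsCompact S := (isCompact_closedBall s₀ 1).prod (isCompact_Icc.image Λ.continuous)
  have hA : ∀ p ∈ S, AnalyticAt ℂ G p := by
    rintro ⟨s, z⟩ ⟨-, t, ht, rfl⟩
    exact hG s t ht
  obtain ⟨C, hC⟩ := hcomp.exists_bound_of_continuousOn (f := fderiv ℂ G)
    fun p hp => (hA p hp).fderiv.continuousAt.continuousWithinAt
  have h0 : (s₀, (0 : Fin n → ℂ)) ∈ S := by
    refine ⟨by simp, 0, by simp, map_zero Λ⟩
  have hC0 : 0 ≤ C := (norm_nonneg _).trans (hC _ h0)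
  refine ⟨C, hC0, fun ε hε t ht => ?_⟩
  have hmem : (s₀ + ε, fun i => (t i : ℂ)) ∈ S := by
    refine ⟨?_, t, ht, rfl⟩
    simpa [abs_of_nonneg hε.1] using hε.2
  refine (hconv.norm_image_sub_le_of_norm_fderiv_le (𝕜 := ℂ)
    (fun p hp => (hA p hp).differentiableAt) hC h0 hmem).trans (mul_le_mul_of_nonneg_left ?_ hC0)
  have hsum : 0 ≤ ∑ j, t j := Finset.sum_nonneg fun j _ => ht.1 j
  rw [Prod.mk_sub_mk, Prod.norm_mk]
  refine max_le ?_ ?_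
  · simpa [abs_of_nonneg hε.1] using hsum
  · refine (pi_norm_le_iff_of_nonneg (add_nonneg hε.1 hsum)).2 fun i => ?_
    have hi := ht.1 i
    simp only [Pi.zero_apply] at hi
    simp only [sub_zero, norm_real, Real.norm_eq_abs, abs_of_nonneg hi]
    have := Finset.single_le_sum (f := t) (fun j _ => ht.1 j) (Finset.mem_univ i)
    linarith [hε.1]

lemma integral_mul_rpow_sub_one {r : ℝ} (hr : 0 < r) :
    ∫ x in Set.Ioc (0 : ℝ) 1, r * x ^ (r - 1) = 1 := by
  rw [integral_const_mul, ← intervalIntegral.integral_of_le zero_le_one,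
    integral_rpow (Or.inl (by linarith))]
  simp [hr.ne', Real.zero_rpow hr.ne']

lemma integral_mul_rpow_sub_one_mul_le {r : ℝ} (hr : 0 < r) :
    ∫ x in Set.Ioc (0 : ℝ) 1, r * x ^ (r - 1) * x ≤ r := by
  have : ∫ x in Set.Ioc (0 : ℝ) 1, r * x ^ (r - 1) * x = ∫ x in Set.Ioc (0 : ℝ) 1, r * x ^ r := by
    refine setIntegral_congr_fun measurableSet_Ioc fun x hx => ?_
    simp only [mul_assoc, ← Real.rpow_add_one hx.1.ne', sub_add_cancel]
  rw [this, integral_const_mul, ← intervalIntegral.integral_of_le zero_le_one,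
    integral_rpow (Or.inl (by linarith))]
  simp only [Real.one_rpow, Real.zero_rpow (by linarith : r + 1 ≠ 0), sub_zero]
  exact mul_le_of_le_one_right hr.le ((div_le_one (by linarith)).2 (by linarith))

lemma integrable_mul_rpow_sub_one {r : ℝ} (hr : 0 < r) :
    Integrable (fun x : ℝ => r * x ^ (r - 1)) (volume.restrict (Set.Ioc (0 : ℝ) 1)) := by
  have := intervalIntegral.intervalIntegrable_rpow' (a := 0) (b := 1) (r := r - 1) (by linarith)
  rw [intervalIntegrable_iff_integrableOn_Ioc_of_le zero_le_one] at this
  exact this.const_mul r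

lemma integrable_mul_rpow_sub_one_mul {r : ℝ} (hr : 0 < r) :
    Integrable (fun x : ℝ => r * x ^ (r - 1) * x) (volume.restrict (Set.Ioc (0 : ℝ) 1)) := by
  refine (integrable_mul_rpow_sub_one hr).mul_of_top_left (memLp_top_of_bound
    measurable_id.aestronglyMeasurable 1 ?_)
  filter_upwards [ae_restrict_mem measurableSet_Ioc] with x hx
  simpa [abs_of_pos hx.1] using hx.2

/-- If all exponents equal `-1` at `s = -m`, the leading coefficient of the cube integral at `-m`
is determined by the value of `G` at the corner `t = 0`. -/
lemma tendsto_pow_mul_cubeIntegral (hG : AnalyticOnUnitCube G) {m : ℕ}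
    (hab : ∀ i, b i + 1 = a i * m) :
    Tendsto (fun ε : ℝ => ((∏ i, a i : ℕ) : ℂ) * ((ε : ℂ) ^ n * cubeIntegral a b G (-m + ε)))
      (nhdsWithin 0 (Set.Ioi 0)) (nhds (G (-m, 0))) := by
  obtain ⟨C, hC0, hC⟩ := hG.exists_lipschitz_bound (-m)
  have ha : ∀ i, 0 < (a i : ℝ) := fun i => by
    have := hab i
    rcases Nat.eq_zero_or_pos (a i) with h | h
    · simp [h] at this
    · exact_mod_cast h
  rw [tendsto_iff_norm_sub_tendsto_zero]
  have hlim : Tendsto (fun ε : ℝ => C * (ε + ∑ j, a j * ε))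
      (nhdsWithin 0 (Set.Ioi 0)) (nhds 0) := by
    have : Continuous fun ε : ℝ => C * (ε + ∑ j, a j * ε) := by fun_prop
    have h := this.tendsto 0
    simp only [mul_zero, Finset.sum_const_zero, add_zero] at h
    exact h.mono_left nhdsWithin_le_nhds
  refine squeeze_zero' (Eventually.of_forall fun _ => norm_nonneg _) ?_ hlim
  filter_upwards [Ioc_mem_nhdsGT (zero_lt_one' ℝ)] with ε hε
  have hr : ∀ i, 0 < a i * ε := fun i => mul_pos (ha i) hε.1
  set ρ : (Fin n → ℝ) → ℝ := fun t => ∏ i, (a i * ε) * t i ^ (a i * ε - 1) with hρ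
  have hρi : Integrable ρ (unitCubeMeasure n) :=
    Integrable.fintype_prod (f := fun i (x : ℝ) => (a i * ε) * x ^ (a i * ε - 1))
      fun i => integrable_mul_rpow_sub_one (hr i)
  have hρ1 : ∫ t, ρ t ∂unitCubeMeasure n = 1 := by
    rw [unitCubeMeasure, hρ,
      integral_fintype_prod_eq_prod (fun i (x : ℝ) => (a i * ε) * x ^ (a i * ε - 1))]
    exact Finset.prod_eq_one fun i _ => integral_mul_rpow_sub_one (hr i)
  set φ : Fin n → Fin n → ℝ → ℝ := fun j i x =>
    if i = j then (a i * ε) * x ^ (a i * ε - 1) * x else (a i * ε) * x ^ (a i * ε - 1) with hφ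
  have hφρ : ∀ j t, ρ t * t j = ∏ i, φ j i (t i) := by
    intro j t
    have : ∀ i, φ j i (t i) = (a i * ε) * t i ^ (a i * ε - 1) * if i = j then t i else 1 := by
      intro i
      by_cases h : i = j <;> simp [hφ, h]
    simp only [this, hρ]
    rw [Finset.prod_mul_distrib (f := fun i => (a i * ε) * t i ^ (a i * ε - 1))]
    simp
  have hρti : ∀ j, Integrable (fun t => ρ t * t j) (unitCubeMeasure n) := by
    intro j
    simp only [hφρ]
    refine Integrable.fintype_prod (f := φ j) fun i => ?_
    by_cases h : i = j
    · simpa [hφ, h] using integrable_mul_rpow_sub_one_mul (hr j)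
    · simpa [hφ, h] using integrable_mul_rpow_sub_one (hr i)
  have hρt : ∀ j, ∫ t, ρ t * t j ∂unitCubeMeasure n ≤ a j * ε := by
    intro j
    simp only [hφρ]
    rw [unitCubeMeasure, integral_fintype_prod_eq_prod (φ j), Finset.prod_eq_single j]
    · simpa [hφ] using integral_mul_rpow_sub_one_mul_le (hr j)
    · intro i _ hij
      simpa [hφ, hij] using integral_mul_rpow_sub_one (hr i)
    · simp
  have hs : ∀ i, -1 < a i * (-(m : ℂ) + ε).re + b i := by
    intro i
    have h1 : (b i : ℝ) + 1 = a i * m := by exact_mod_cast hab i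
    have h2 := hr i
    simp only [add_re, neg_re, natCast_re, ofReal_re]
    linarith
  have hpt : ∀ t : Fin n → ℝ, (∀ i, t i ∈ Set.Ioc (0 : ℝ) 1) →
      ((∏ i, a i : ℕ) : ℂ) * ((ε : ℂ) ^ n * cubeIntegrand a b G (-m + ε) t) =
        (ρ t : ℂ) * G (-m + ε, fun i => (t i : ℂ)) := by
    intro t ht
    have h1 : ∀ i, (t i : ℂ) ^ ((a i : ℂ) * (-m + ε) + b i) = ((t i ^ (a i * ε - 1) : ℝ) : ℂ) := by
      intro i
      have h1 : (b i : ℂ) + 1 = a i * m := by exact_mod_cast hab i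
      rw [ofReal_cpow (ht i).1.le]
      congr 1
      push_cast
      linear_combination h1
    simp only [cubeIntegrand, h1, hρ, ofReal_prod, Nat.cast_prod, ofReal_mul,
      Finset.prod_mul_distrib, ofReal_natCast, Finset.prod_const, Finset.card_univ,
      Fintype.card_fin, ofReal_pow]
    ring
  have hInt : Integrable (fun t => (ρ t : ℂ) * G (-m + ε, fun i => (t i : ℂ)))
      (unitCubeMeasure n) := by
    refine (((integrable_cubeIntegrand hG hs).const_mul ((ε : ℂ) ^ n)).const_mul
      ((∏ i, a i : ℕ) : ℂ)).congr ?_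
    filter_upwards [ae_unitCubeMeasure n] with t ht using hpt t ht
  have hdiff : ((∏ i, a i : ℕ) : ℂ) * ((ε : ℂ) ^ n * cubeIntegral a b G (-m + ε)) - G (-m, 0) =
      ∫ t, (ρ t : ℂ) * (G (-m + ε, fun i => (t i : ℂ)) - G (-m, 0)) ∂unitCubeMeasure n := by
    have hρi' : Integrable (fun t => (ρ t : ℂ)) (unitCubeMeasure n) := hρi.ofReal
    simp only [mul_sub]
    rw [integral_sub hInt (hρi'.mul_const _), integral_mul_const, integral_complex_ofReal,
      hρ1, ofReal_one, one_mul, cubeIntegral, ← integral_const_mul, ← integral_const_mul]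
    congr 1
    refine integral_congr_ae ?_
    filter_upwards [ae_unitCubeMeasure n] with t ht using hpt t ht
  rw [hdiff]
  have hbi : Integrable (fun t => C * (ρ t * ε + ∑ j, ρ t * t j)) (unitCubeMeasure n) :=
    ((hρi.mul_const ε).add (integrable_finsetSum _ fun j _ => hρti j)).const_mul C
  refine (norm_integral_le_of_norm_le hbi ?_).trans ?_
  · filter_upwards [ae_unitCubeMeasure n] with t ht
    have hρ0 : 0 ≤ ρ t := Finset.prod_nonneg fun i _ =>
      mul_nonneg (hr i).le (Real.rpow_nonneg (ht i).1.le _)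
    rw [norm_mul, norm_real, Real.norm_eq_abs, abs_of_nonneg hρ0, ← Finset.mul_sum, ← mul_add]
    calc ρ t * _ ≤ ρ t * (C * (ε + ∑ j, t j)) := mul_le_mul_of_nonneg_left
          (hC ε ⟨hε.1.le, hε.2⟩ t (mem_Icc_of_forall_mem_Ioc ht)) hρ0
      _ = _ := by ring
  · rw [integral_const_mul, integral_add (hρi.mul_const ε)
      (integrable_finsetSum _ fun j _ => hρti j), integral_mul_const, hρ1, one_mul,
      integral_finsetSum _ fun j _ => hρti j]
    exact mul_le_mul_of_nonneg_left
      (add_le_add le_rfl (Finset.sum_le_sum fun j _ => hρt j)) hC0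

lemma leadingCoeff_eq_of_tendsto (hG : AnalyticOnUnitCube G) {m : ℕ}
    (hab : ∀ i, b i + 1 = a i * m) {F : ℂ → ℂ} {L : ℂ}
    (hF : ∀ s : ℂ, (∀ i, -1 < a i * s.re + b i) → F s = cubeIntegral a b G s)
    (hL : Tendsto (fun s => (s + (m : ℂ)) ^ n * F s) (nhdsWithin (-(m : ℂ)) {-(m : ℂ)}ᶜ)
      (nhds L)) :
    ((∏ i, a i : ℕ) : ℂ) * L = G (-m, 0) := by
  have ha : ∀ i, 0 < (a i : ℝ) := fun i => by
    have := hab i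
    rcases Nat.eq_zero_or_pos (a i) with h | h
    · simp [h] at this
    · exact_mod_cast h
  have hpath : Tendsto (fun ε : ℝ => -(m : ℂ) + ε) (nhdsWithin 0 (Set.Ioi 0))
      (nhdsWithin (-(m : ℂ)) {-(m : ℂ)}ᶜ) := by
    refine tendsto_nhdsWithin_iff.2 ⟨?_, ?_⟩
    · have : Continuous fun ε : ℝ => -(m : ℂ) + ε := by fun_prop
      simpa using (this.tendsto 0).mono_left nhdsWithin_le_nhds
    · filter_upwards [self_mem_nhdsWithin] with ε hε
      simpa using (Set.mem_Ioi.1 hε).ne'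
  have h1 := (hL.comp hpath).const_mul ((∏ i, a i : ℕ) : ℂ)
  refine tendsto_nhds_unique (h1.congr' ?_) (tendsto_pow_mul_cubeIntegral hG hab)
  filter_upwards [self_mem_nhdsWithin] with ε hε
  have hs : ∀ i, -1 < a i * (-(m : ℂ) + ε).re + b i := by
    intro i
    have h1 : (b i : ℝ) + 1 = a i * m := by exact_mod_cast hab i
    have h2 := mul_pos (ha i) hε
    simp only [add_re, neg_re, natCast_re, ofReal_re]
    linarith
  simp only [Function.comp_apply, hF _ hs]
  ring_nf

end LeadingCoefficient

section RationalForm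

variable {n : ℕ} {σ : Type*} {𝒱 : Submodule ℚ ℂ}

lemma MvPolynomial.coeff_mul_map_mem {Q : MvPolynomial σ ℂ} (hQ : ∀ d, Q.coeff d ∈ 𝒱)
    (u : MvPolynomial σ ℚ) (d : σ →₀ ℕ) :
    (Q * MvPolynomial.map (algebraMap ℚ ℂ) u).coeff d ∈ 𝒱 := by
  classical
  rw [MvPolynomial.coeff_mul]
  refine Submodule.sum_mem _ fun x _ => ?_
  rw [MvPolynomial.coeff_map, mul_comm, ← Algebra.smul_def]
  exact 𝒱.smul_mem _ (hQ _)

lemma MvPolynomial.coeff_pderiv_mem {Q : MvPolynomial σ ℂ} (hQ : ∀ d, Q.coeff d ∈ 𝒱)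
    (i : σ) (d : σ →₀ ℕ) : (MvPolynomial.pderiv i Q).coeff d ∈ 𝒱 := by
  rw [MvPolynomial.coeff_pderiv, mul_comm]
  have : ((d i : ℂ) + 1) = algebraMap ℚ ℂ (d i + 1) := by simp
  rw [this, ← Algebra.smul_def]
  exact 𝒱.smul_mem _ (hQ _)

lemma MvPolynomial.hasDerivAt_eval_insertNth (Q : MvPolynomial (Fin (n + 1)) ℂ)
    (i : Fin (n + 1)) (x : ℝ) (y : Fin n → ℝ) :
    HasDerivAt (fun x : ℝ => MvPolynomial.eval
        (fun j => ((i.insertNth x y : Fin (n + 1) → ℝ) j : ℂ)) Q)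
      (MvPolynomial.eval (fun j => ((i.insertNth x y : Fin (n + 1) → ℝ) j : ℂ))
        (MvPolynomial.pderiv i Q)) x := by
  induction Q using MvPolynomial.induction_on with
  | C a => simpa using hasDerivAt_const x a
  | add p q hp hq => simpa using hp.fun_add hq
  | mul_X p j hp =>
    have hX : HasDerivAt (fun x : ℝ => ((i.insertNth x y : Fin (n + 1) → ℝ) j : ℂ))
        (if j = i then 1 else 0) x := by
      refine Fin.succAboveCases i ?_ (fun l => ?_) j
      · simpa using (hasDerivAt_id' x).ofReal_comp
      · simpa using hasDerivAt_const x ((y l : ℝ) : ℂ)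
    have h := hp.fun_mul hX
    simp only [MvPolynomial.eval_mul, MvPolynomial.eval_X, MvPolynomial.pderiv_mul,
      MvPolynomial.pderiv_X, map_add]
    refine h.congr_deriv ?_
    by_cases hji : j = i
    · subst hji
      simp [add_comm]
    · simp [hji]

/-- `G(s, ·)` is a quotient of a polynomial with coefficients in `𝒱` by a polynomial with
rational coefficients that does not vanish at the origin. -/
def HasRationalForm (𝒱 : Submodule ℚ ℂ) (G : ℂ × (Fin n → ℂ) → ℂ) (s : ℂ) : Prop :=
  ∃ (u : MvPolynomial (Fin n) ℚ) (Q : MvPolynomial (Fin n) ℂ),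
    u.coeff 0 ≠ 0 ∧ (∀ d, Q.coeff d ∈ 𝒱) ∧ ∀ t ∈ Set.Icc (0 : Fin n → ℝ) 1,
      G (s, fun i => (t i : ℂ)) *
        MvPolynomial.eval (fun i => (t i : ℂ)) (MvPolynomial.map (algebraMap ℚ ℂ) u) =
      MvPolynomial.eval (fun i => (t i : ℂ)) Q

lemma HasRationalForm.apply_zero_mem {G : ℂ × (Fin n → ℂ) → ℂ} {s : ℂ}
    (h : HasRationalForm 𝒱 G s) : G (s, 0) ∈ 𝒱 := by
  obtain ⟨u, Q, hu, hQ, hG⟩ := h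
  have h0 := hG 0 (by simp)
  have hz : (fun i : Fin n => (((0 : Fin n → ℝ) i : ℝ) : ℂ)) = 0 := by ext; simp
  rw [hz, MvPolynomial.eval_zero, MvPolynomial.constantCoeff_map,
    MvPolynomial.constantCoeff_eq, MvPolynomial.constantCoeff_eq] at h0
  have hu' : algebraMap ℚ ℂ (u.coeff 0) ≠ 0 := by simpa using hu
  have : G (s, 0) = (u.coeff 0)⁻¹ • Q.coeff 0 := by
    rw [← h0, Algebra.smul_def, map_inv₀]
    field_simp
  rw [this]
  exact 𝒱.smul_mem _ (hQ 0)

lemma HasRationalForm.partialDeriv {G : ℂ × (Fin (n + 1) → ℂ) → ℂ} {s : ℂ}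
    (h : HasRationalForm 𝒱 G s) (hG : AnalyticOnUnitCube G) (i : Fin (n + 1)) :
    HasRationalForm 𝒱 (cubePartial i G) s := by
  obtain ⟨u, Q, hu, hQ, hGQ⟩ := h
  refine ⟨u * u, MvPolynomial.pderiv i Q * MvPolynomial.map (algebraMap ℚ ℂ) u -
    Q * MvPolynomial.map (algebraMap ℚ ℂ) (MvPolynomial.pderiv i u), ?_, fun d => ?_,
    fun t ht => ?_⟩
  · rw [← MvPolynomial.constantCoeff_eq] at hu ⊢
    simpa using hu
  · rw [MvPolynomial.coeff_sub]
    exact 𝒱.sub_mem (MvPolynomial.coeff_mul_map_mem (MvPolynomial.coeff_pderiv_mem hQ i) _ _)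
      (MvPolynomial.coeff_mul_map_mem hQ _ _)
  · obtain ⟨x, y, rfl⟩ : ∃ x y, t = (i.insertNth x y : Fin (n + 1) → ℝ) :=
      ⟨t i, i.removeNth t, by simp⟩
    have hx : x ∈ Set.Icc (0 : ℝ) 1 := by
      simpa using And.intro (ht.1 i) (ht.2 i)
    have hy : y ∈ Set.Icc (0 : Fin n → ℝ) 1 :=
      ⟨fun j => by simpa using ht.1 (i.succAbove j), fun j => by simpa using ht.2 (i.succAbove j)⟩
    have h1 := (hG.hasDerivAt_insertNth i s hx hy).mul
      (MvPolynomial.hasDerivAt_eval_insertNth (MvPolynomial.map (algebraMap ℚ ℂ) u) i x y)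
    have h2 := MvPolynomial.hasDerivAt_eval_insertNth Q i x y
    have h3 := (uniqueDiffOn_Icc_zero_one x hx).eq_deriv _ h1.hasDerivWithinAt
      (h2.hasDerivWithinAt.congr
        (fun z hz => by simpa using hGQ _ (i.insertNth_mem_Icc_zero_one hz hy))
        (by simpa using hGQ _ ht))
    rw [MvPolynomial.pderiv_map] at h3
    have h4 := hGQ _ ht
    simp only [map_mul, map_sub]
    rw [← h3, ← h4]
    ring

end RationalForm

section Continuation

variable {n : ℕ} {𝒱 : Submodule ℚ ℂ}

/-- An upper bound for the order of the pole at `-m` of the continuation of `cubeIntegral a b G`. -/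
def poleCount (a b : Fin n → ℕ) (m : ℕ) : ℕ :=
  ∑ i, if b i + 1 ≤ a i * m then 1 else 0

/-- `F` is a meromorphic continuation of `cubeIntegral a b G` to the half plane `-N < re s`, whose
leading coefficient at `-m` lies in `𝒱` provided that the expected pole order is maximal and
`G(-m, ·)` is a rational form with coefficients in `𝒱`. -/
def IsContinuation (𝒱 : Submodule ℚ ℂ) (m N : ℕ) (a b : Fin n → ℕ) (G : ℂ × (Fin n → ℂ) → ℂ)
    (F : ℂ → ℂ) : Prop :=
  (∀ z : ℂ, -(N : ℝ) < z.re → MeromorphicAt F z) ∧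
  (∀ s : ℂ, (∀ i, -1 < a i * s.re + b i) → F s = cubeIntegral a b G s) ∧
  ∃ L, Tendsto (fun s => (s + (m : ℂ)) ^ poleCount a b m * F s)
      (nhdsWithin (-(m : ℂ)) {-(m : ℂ)}ᶜ) (nhds L) ∧
    (poleCount a b m = n → HasRationalForm 𝒱 G (-m) → L ∈ 𝒱)

lemma poleCount_eq_succAbove (a b : Fin (n + 1) → ℕ) (m : ℕ) (i : Fin (n + 1)) :
    poleCount a b m = (if b i + 1 ≤ a i * m then 1 else 0) +
      poleCount (fun j => a (i.succAbove j)) (fun j => b (i.succAbove j)) m :=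
  Fin.sum_univ_succAbove _ i

lemma poleCount_update (a b : Fin (n + 1) → ℕ) (m : ℕ) (i : Fin (n + 1)) (c : ℕ) :
    poleCount a (Function.update b i c) m = (if c + 1 ≤ a i * m then 1 else 0) +
      poleCount (fun j => a (i.succAbove j)) (fun j => b (i.succAbove j)) m := by
  rw [poleCount_eq_succAbove _ _ _ i]
  simp

lemma poleCount_le (a b : Fin n → ℕ) (m : ℕ) : poleCount a b m ≤ n := by
  refine (Finset.sum_le_card_nsmul _ _ 1 fun i _ => ?_).trans (by simp)
  split_ifs <;> simp

lemma le_of_poleCount_eq {a b : Fin n → ℕ} {m : ℕ} (h : poleCount a b m = n) (i : Fin n) :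
    b i + 1 ≤ a i * m := by
  by_contra hi
  have : poleCount a b m < ∑ _i : Fin n, 1 := by
    refine Finset.sum_lt_sum (fun j _ => ?_) ⟨i, Finset.mem_univ i, by simp [hi]⟩
    split_ifs <;> simp
  simp [h] at this

lemma ratCast_mul_mem {z : ℂ} (hz : z ∈ 𝒱) (q : ℚ) : (q : ℂ) * z ∈ 𝒱 := by
  have := 𝒱.smul_mem q hz
  rwa [Algebra.smul_def, eq_ratCast] at this

lemma limit_mem_of_hasRationalForm {a b : Fin n → ℕ} {G : ℂ × (Fin n → ℂ) → ℂ}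
    (hG : AnalyticOnUnitCube G) {m : ℕ} (hab : ∀ i, b i + 1 = a i * m) {F : ℂ → ℂ} {L : ℂ}
    (hF : ∀ s : ℂ, (∀ i, -1 < a i * s.re + b i) → F s = cubeIntegral a b G s)
    (hL : Tendsto (fun s => (s + (m : ℂ)) ^ n * F s) (nhdsWithin (-(m : ℂ)) {-(m : ℂ)}ᶜ)
      (nhds L)) (hR : HasRationalForm 𝒱 G (-m)) : L ∈ 𝒱 := by
  have h := leadingCoeff_eq_of_tendsto hG hab hF hL
  have ha : ((∏ i, a i : ℕ) : ℂ) ≠ 0 := by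
    rw [Nat.cast_ne_zero, Finset.prod_ne_zero_iff]
    intro i _ hi
    have := hab i
    simp [hi] at this
  have hL' : L = (((∏ i, a i : ℕ) : ℚ)⁻¹ : ℚ) * G (-m, 0) := by
    rw [← h, Rat.cast_inv, Rat.cast_natCast, inv_mul_cancel_left₀ ha]
  rw [hL']
  exact ratCast_mul_mem hR.apply_zero_mem _

lemma isContinuation_cubeIntegral {a b : Fin n → ℕ} {G : ℂ × (Fin n → ℂ) → ℂ}
    (hG : AnalyticOnUnitCube G) {m N : ℕ} (hmN : m < N) (h : ∀ i, a i * N ≤ b i + 1) :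
    IsContinuation 𝒱 m N a b G (cubeIntegral a b G) := by
  have hs : ∀ z : ℂ, -(N : ℝ) < z.re → ∀ i, -1 < a i * z.re + b i := by
    intro z hz i
    have h1 : (a i : ℝ) * N ≤ b i + 1 := by exact_mod_cast h i
    rcases Nat.eq_zero_or_pos (a i) with ha | ha
    · have : (0 : ℝ) ≤ b i := by positivity
      simp only [ha, Nat.cast_zero, zero_mul]
      linarith
    · have ha' : (0 : ℝ) < a i := by exact_mod_cast ha
      nlinarith
  have hd : DifferentiableOn ℂ (cubeIntegral a b G) {z | -(N : ℝ) < z.re} := fun z hz =>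
    (differentiableAt_cubeIntegral hG (hs z hz)).differentiableWithinAt
  have ho : IsOpen {z : ℂ | -(N : ℝ) < z.re} := isOpen_lt continuous_const continuous_re
  have hlt : ∀ i, ¬ b i + 1 ≤ a i * m := by
    intro i hi
    rcases Nat.eq_zero_or_pos (a i) with ha | ha
    · simp [ha] at hi
    · have := h i
      nlinarith
  have hp : poleCount a b m = 0 := by simp [poleCount, hlt]
  have hmem : -(N : ℝ) < (-(m : ℂ)).re := by
    simpa using hmN
  have hL : Tendsto (fun s => (s + (m : ℂ)) ^ poleCount a b m * cubeIntegral a b G s)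
      (nhdsWithin (-(m : ℂ)) {-(m : ℂ)}ᶜ) (nhds (cubeIntegral a b G (-m))) := by
    simp only [hp, pow_zero, one_mul]
    exact ((differentiableAt_cubeIntegral hG (hs _ hmem)).continuousAt.tendsto).mono_left
      nhdsWithin_le_nhds
  refine ⟨fun z hz => (hd.analyticAt (ho.mem_nhds hz)).meromorphicAt, fun s _ => rfl, _, hL,
    fun hn hR => ?_⟩
  rw [hn] at hL
  exact limit_mem_of_hasRationalForm hG (fun i => absurd (le_of_poleCount_eq hn i) (hlt i))
    (fun s _ => rfl) hL hR

lemma IsContinuation.of_face_of_partial {a b : Fin (n + 1) → ℕ} {G : ℂ × (Fin (n + 1) → ℂ) → ℂ}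
    (hG : AnalyticOnUnitCube G) {m N : ℕ} (i : Fin (n + 1))
    (hi : b i + 1 < a i * m ∨ ∀ j, a j * m ≤ b j + 1) {F₁ F₂ : ℂ → ℂ}
    (h₁ : IsContinuation 𝒱 m N (fun j => a (i.succAbove j)) (fun j => b (i.succAbove j))
      (cubeFace i G) F₁)
    (h₂ : IsContinuation 𝒱 m N a (Function.update b i (b i + 1)) (cubePartial i G) F₂) :
    IsContinuation 𝒱 m N a b G
      fun s => ((a i : ℂ) * s + b i + 1)⁻¹ * (F₁ s - F₂ s) := by
  obtain ⟨hm₁, hF₁, L₁, hL₁, -⟩ := h₁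
  obtain ⟨hm₂, hF₂, L₂, hL₂, hV₂⟩ := h₂
  have hlin : ∀ z : ℂ, AnalyticAt ℂ (fun s : ℂ => (a i : ℂ) * s + b i + 1) z := fun z => by
    fun_prop
  have hF : ∀ s : ℂ, (∀ i, -1 < a i * s.re + b i) →
      ((a i : ℂ) * s + b i + 1)⁻¹ * (F₁ s - F₂ s) = cubeIntegral a b G s := by
    intro s hs
    rw [cubeIntegral_eq_face_sub_partial hG i hs, hF₁ s fun j => hs _, hF₂ s fun j => ?_]
    rcases eq_or_ne j i with rfl | hj
    · have := hs j
      simp only [Function.update_self, Nat.cast_add, Nat.cast_one]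
      linarith
    · simpa [hj] using hs j
  refine ⟨fun z hz => (hlin z).meromorphicAt.inv.mul ((hm₁ z hz).sub (hm₂ z hz)), hF, ?_⟩
  rw [poleCount_update] at hL₂ hV₂
  rw [poleCount_eq_succAbove a b m i]
  set d := poleCount (fun j => a (i.succAbove j)) (fun j => b (i.succAbove j)) m with hd
  have hzero : Tendsto (fun s : ℂ => s + (m : ℂ)) (nhdsWithin (-(m : ℂ)) {-(m : ℂ)}ᶜ) (nhds 0) := by
    have : Continuous fun s : ℂ => s + (m : ℂ) := by fun_prop
    simpa using (this.tendsto (-(m : ℂ))).mono_left nhdsWithin_le_nhds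
  have hinv : b i + 1 ≠ a i * m → Tendsto (fun s : ℂ => ((a i : ℂ) * s + b i + 1)⁻¹)
      (nhdsWithin (-(m : ℂ)) {-(m : ℂ)}ᶜ) (nhds ((a i : ℂ) * (-m) + b i + 1)⁻¹) := by
    intro hne
    refine Tendsto.inv₀ ((hlin _).continuousAt.tendsto.mono_left nhdsWithin_le_nhds) fun h0 => ?_
    apply hne
    have : (b i : ℂ) + 1 = a i * m := by linear_combination h0
    exact_mod_cast this
  rcases lt_or_ge (b i + 1) (a i * m) with hlt | hge
  · rw [if_pos (Nat.succ_le_of_lt hlt)] at hL₂ hV₂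
    rw [if_pos hlt.le]
    refine ⟨((a i : ℂ) * (-m) + b i + 1)⁻¹ * (0 * L₁ - L₂), ?_, fun hn hR => ?_⟩
    · refine ((hinv hlt.ne).mul ((hzero.mul hL₁).sub hL₂)).congr fun s => ?_
      ring
    · have := ratCast_mul_mem (hV₂ hn (hR.partialDeriv hG i))
        (-(((a i : ℚ) * (-m) + b i + 1)⁻¹))
      convert this using 1
      push_cast
      ring
  · have hall : ∀ j, a j * m ≤ b j + 1 := hi.resolve_left hge.not_gt
    rw [if_neg (by lia), zero_add] at hL₂
    suffices h : ∃ L, Tendsto (fun s : ℂ => (s + (m : ℂ)) ^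
        ((if b i + 1 ≤ a i * m then 1 else 0) + d) *
          (((a i : ℂ) * s + b i + 1)⁻¹ * (F₁ s - F₂ s)))
        (nhdsWithin (-(m : ℂ)) {-(m : ℂ)}ᶜ) (nhds L) by
      obtain ⟨L, hL⟩ := h
      refine ⟨L, hL, fun hn hR => ?_⟩
      rw [hn] at hL
      rw [hd, ← poleCount_eq_succAbove] at hn
      exact limit_mem_of_hasRationalForm hG
        (fun j => le_antisymm (le_of_poleCount_eq hn j) (hall j)) hF hL hR
    rcases hge.eq_or_lt with heq | hlt
    · have ha : (a i : ℂ) ≠ 0 := by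
        rw [Nat.cast_ne_zero]
        rintro h0
        simp [h0] at heq
      rw [if_pos heq.ge]
      refine ⟨(a i : ℂ)⁻¹ * (L₁ - L₂), ((hL₁.sub hL₂).const_mul (a i : ℂ)⁻¹).congr' ?_⟩
      filter_upwards [self_mem_nhdsWithin] with s hs
      have hs' : s + m ≠ 0 := fun h => hs (eq_neg_of_add_eq_zero_left h)
      have hb : (b i : ℂ) + 1 = a i * m := by exact_mod_cast heq.symm
      have : (a i : ℂ) * s + b i + 1 = a i * (s + m) := by linear_combination hb
      rw [this]
      field_simp
      ring
    · rw [if_neg (by lia), zero_add]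
      refine ⟨_, ((hinv hlt.ne').mul (hL₁.sub hL₂)).congr fun s => ?_⟩
      ring

theorem exists_isContinuation {m N : ℕ} (hmN : m < N) (a b : Fin n → ℕ)
    {G : ℂ × (Fin n → ℂ) → ℂ} (hG : AnalyticOnUnitCube G) :
    ∃ F, IsContinuation 𝒱 m N a b G F := by
  induction hk : ∑ i, (a i * N - b i) using Nat.strong_induction_on generalizing n with
  | _ k ih =>
  by_cases hall : ∀ i, a i * N ≤ b i + 1
  · exact ⟨_, isContinuation_cubeIntegral hG hmN hall⟩
  obtain ⟨i, hiN, hi⟩ : ∃ i, b i + 1 < a i * N ∧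
      (b i + 1 < a i * m ∨ ∀ j, a j * m ≤ b j + 1) := by
    by_cases h : ∃ i, b i + 1 < a i * m
    · obtain ⟨i, hi⟩ := h
      exact ⟨i, hi.trans_le (Nat.mul_le_mul_left _ hmN.le), Or.inl hi⟩
    · push Not at h hall
      obtain ⟨i, hi⟩ := hall
      exact ⟨i, hi, Or.inr h⟩
  obtain _ | n := n
  · exact i.elim0
  rw [Fin.sum_univ_succAbove _ i] at hk
  obtain ⟨F₁, h₁⟩ := ih (∑ j, (a (i.succAbove j) * N - b (i.succAbove j))) (by lia)
    (fun j => a (i.succAbove j)) (fun j => b (i.succAbove j)) (hG.face i) rfl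
  obtain ⟨F₂, h₂⟩ := ih (a i * N - (b i + 1) + ∑ j, (a (i.succAbove j) * N - b (i.succAbove j)))
    (by lia) a (Function.update b i (b i + 1)) (hG.partialDeriv i)
    (by rw [Fin.sum_univ_succAbove _ i]; simp)
  exact ⟨_, IsContinuation.of_face_of_partial hG i hi h₁ h₂⟩

end Continuation

section Gluing

lemma eventuallyEq_of_meromorphicAt_of_re_lt {f g : ℂ → ℂ} {r : ℝ}
    (hf : ∀ z : ℂ, r < z.re → MeromorphicAt f z) (hg : ∀ z : ℂ, r < z.re → MeromorphicAt g z)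
    {r' : ℝ} (hfg : ∀ z : ℂ, r' < z.re → f z = g z) {z : ℂ} (hz : r < z.re) :
    f =ᶠ[nhdsWithin z {z}ᶜ] g := by
  have hU : IsPreconnected {z : ℂ | r < z.re} :=
    (convex_halfSpace_re_gt r).isPreconnected
  have hm : MeromorphicOn (f - g) {z : ℂ | r < z.re} := fun z hz => (hf z hz).sub (hg z hz)
  set w : ℂ := ((max r r' + 1 : ℝ) : ℂ) with hw
  have hwr : w.re = max r r' + 1 := ofReal_re _
  have hwU : r < w.re := by
    rw [hwr]; linarith [le_max_left r r']
  have hwr' : r' < w.re := by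
    rw [hwr]; linarith [le_max_right r r']
  have hwtop : meromorphicOrderAt (f - g) w = ⊤ := by
    rw [meromorphicOrderAt_eq_top_iff]
    have ho : IsOpen {z : ℂ | r' < z.re} := isOpen_lt continuous_const continuous_re
    refine Filter.Eventually.filter_mono nhdsWithin_le_nhds ?_
    filter_upwards [ho.mem_nhds hwr'] with s hs
    simp [hfg s hs]
  have htop : meromorphicOrderAt (f - g) z = ⊤ := by
    by_contra h
    exact hm.meromorphicOrderAt_ne_top_of_isPreconnected hU hz hwU h hwtop
  rw [meromorphicOrderAt_eq_top_iff] at htop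
  filter_upwards [htop] with s hs
  exact sub_eq_zero.1 hs

lemma exists_meromorphicAt_of_halfPlanes {I : ℂ → ℂ} (F : ℕ → ℂ → ℂ)
    (hF : ∀ (N : ℕ) (z : ℂ), -(N : ℝ) < z.re → MeromorphicAt (F N) z)
    (hI : ∀ (N : ℕ) (s : ℂ), 0 < s.re → F N s = I s) :
    ∃ F' : ℂ → ℂ, (∀ z, MeromorphicAt F' z) ∧ (∀ s, 0 < s.re → F' s = I s) ∧
      ∀ (N : ℕ) (z : ℂ), -(N : ℝ) < z.re → F' =ᶠ[nhdsWithin z {z}ᶜ] F N := by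
  have hFF : ∀ (M N : ℕ) (z : ℂ), -(M : ℝ) < z.re → -(N : ℝ) < z.re →
      F M =ᶠ[nhdsWithin z {z}ᶜ] F N := by
    intro M N z hM hN
    refine eventuallyEq_of_meromorphicAt_of_re_lt (r := max (-(M : ℝ)) (-(N : ℝ))) (r' := 0)
      (fun w hw => hF M w ((le_max_left _ _).trans_lt hw))
      (fun w hw => hF N w ((le_max_right _ _).trans_lt hw))
      (fun w hw => (hI M w hw).trans (hI N w hw).symm) (max_lt hM hN)
  have key : ∀ (N : ℕ) (z : ℂ), -(N : ℝ) < z.re →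
      (fun s => F (⌈|s.re|⌉₊ + 2) s) =ᶠ[nhdsWithin z {z}ᶜ] F N := by
    intro N z hz
    have h1 : ∀ᶠ s in nhdsWithin z {z}ᶜ, ∀ M ∈ (Finset.range (⌈|z.re| + 1⌉₊ + 3)),
        -(M : ℝ) < z.re → F M s = F N s := by
      rw [Filter.eventually_all_finset]
      intro M _
      by_cases hM : -(M : ℝ) < z.re
      · filter_upwards [hFF M N z hM hz] with s hs _ using hs
      · exact Eventually.of_forall fun s h => absurd h hM
    filter_upwards [h1, nhdsWithin_le_nhds (Metric.ball_mem_nhds z one_pos)] with s hs hsz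
    have hd : |s.re - z.re| < 1 := by
      rw [Metric.mem_ball, dist_eq_norm] at hsz
      exact (abs_re_le_norm (s - z)).trans_lt hsz
    have hle := abs_sub_abs_le_abs_sub s.re z.re
    have hle' := abs_sub_abs_le_abs_sub z.re s.re
    rw [abs_sub_comm] at hle'
    refine hs _ ?_ ?_
    · rw [Finset.mem_range]
      have : ⌈|s.re|⌉₊ ≤ ⌈|z.re| + 1⌉₊ := Nat.ceil_mono (by linarith)
      lia
    · have := Nat.le_ceil |s.re|
      push_cast
      linarith [neg_abs_le z.re]
  refine ⟨_, fun z => ?_, fun s hs => hI _ s hs, key⟩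
  have hz : -((⌈|z.re|⌉₊ + 1 : ℕ) : ℝ) < z.re := by
    have := Nat.le_ceil |z.re|
    push_cast
    linarith [neg_abs_le z.re]
  exact (hF _ z hz).congr (key _ z hz).symm

end Gluing

lemma IsContinuation.exists_tendsto_pow_mul {n : ℕ} {𝒱 : Submodule ℚ ℂ} {m N : ℕ} {a b : Fin n → ℕ}
    {G : ℂ × (Fin n → ℂ) → ℂ} {F : ℂ → ℂ} (h : IsContinuation 𝒱 m N a b G F)
    (hG : HasRationalForm 𝒱 G (-m)) :
    ∃ L ∈ 𝒱, Tendsto (fun s => (s + (m : ℂ)) ^ n * F s)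
      (nhdsWithin (-(m : ℂ)) {-(m : ℂ)}ᶜ) (nhds L) := by
  obtain ⟨-, -, L, hL, hV⟩ := h
  rcases (poleCount_le a b m).eq_or_lt with heq | hlt
  · rw [heq] at hL
    exact ⟨L, hV heq hG, hL⟩
  · refine ⟨0, 𝒱.zero_mem, ?_⟩
    have hc : Continuous fun s : ℂ => (s + (m : ℂ)) ^ (n - poleCount a b m) := by fun_prop
    have h0 := (hc.tendsto (-(m : ℂ))).mono_left
      (nhdsWithin_le_nhds (s := {-(m : ℂ)}ᶜ))
    rw [neg_add_cancel, zero_pow (Nat.sub_ne_zero_of_lt hlt)] at h0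
    have := h0.mul hL
    rw [zero_mul] at this
    refine this.congr fun s => ?_
    rw [← mul_assoc, ← pow_add, Nat.sub_add_cancel hlt.le]

theorem exists_meromorphicAt_sum_cubeIntegral {n : ℕ} {𝒱 : Submodule ℚ ℂ} {ι : Type*} [Fintype ι]
    (a b : ι → Fin n → ℕ) (G : ι → ℂ × (Fin n → ℂ) → ℂ) (hG : ∀ σ, AnalyticOnUnitCube (G σ))
    (m : ℕ) (hR : ∀ σ, HasRationalForm 𝒱 (G σ) (-m)) :
    ∃ F : ℂ → ℂ, (∀ z, MeromorphicAt F z) ∧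
      (∀ s : ℂ, 0 < s.re → F s = ∑ σ, cubeIntegral (a σ) (b σ) (G σ) s) ∧
      ∃ L ∈ 𝒱, Tendsto (fun s => (s + (m : ℂ)) ^ n * F s)
        (nhdsWithin (-(m : ℂ)) {-(m : ℂ)}ᶜ) (nhds L) := by
  have hex := fun (N : ℕ) (σ : ι) => exists_isContinuation (𝒱 := 𝒱)
    (show m < m + 1 + N by lia) (a σ) (b σ) (hG σ)
  choose F hF using hex
  have hneg : ∀ N : ℕ, ∀ z : ℂ, -(N : ℝ) < z.re → -((m + 1 + N : ℕ) : ℝ) < z.re := by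
    intro N z hz
    push_cast
    have : (0 : ℝ) ≤ m := by positivity
    linarith
  obtain ⟨F', hmer, hI, heq⟩ := exists_meromorphicAt_of_halfPlanes
    (I := fun s => ∑ σ, cubeIntegral (a σ) (b σ) (G σ) s) (fun N s => ∑ σ, F N σ s)
    (fun N z hz => MeromorphicAt.fun_sum fun σ _ => (hF N σ).1 z (hneg N z hz))
    (fun N s hs => Finset.sum_congr rfl fun σ _ => (hF N σ).2.1 s fun i => by
      have h1 : (0 : ℝ) ≤ a σ i * s.re := by positivity
      have h2 : (0 : ℝ) ≤ b σ i := by positivity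
      linarith)
  refine ⟨F', hmer, hI, ?_⟩
  choose L hL𝒱 hL using fun σ => (hF (m + 1) σ).exists_tendsto_pow_mul (hR σ)
  refine ⟨∑ σ, L σ, 𝒱.sum_mem fun σ _ => hL𝒱 σ, ?_⟩
  refine (tendsto_finsetSum _ fun σ _ => hL σ).congr' ?_
  filter_upwards [heq (m + 1) (-m) (by simp)] with s hs
  rw [hs, Finset.mul_sum]

section Chain

variable {R S : Type*} [CommRing R] [CommRing S] {n : ℕ}

/-- Extension of a finite sequence by zero. -/
def zeroExtend (x : Fin n → R) (k : ℕ) : R := if h : k < n then x ⟨k, h⟩ else 0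

/-- The product `x_e ⋯ x_{k-1}`, which vanishes as soon as `e ≤ n < k`. -/
def chainProd (x : Fin n → R) (e k : ℕ) : R := ∏ l ∈ Finset.Ico e k, zeroExtend x l

/-- The affine combination of `φ e, …, φ n` with weights
`chainProd x e i - chainProd x e (i + 1)`. -/
def chainSum (φ : ℕ → R) (e : ℕ) (x : Fin n → R) : R :=
  ∑ i ∈ Finset.Ico e (n + 1), (chainProd x e i - chainProd x e (i + 1)) * φ i

@[simp] lemma zeroExtend_val (x : Fin n → R) (i : Fin n) : zeroExtend x i = x i := by
  simp [zeroExtend]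

@[simp] lemma zeroExtend_self (x : Fin n → R) : zeroExtend x n = 0 := by
  simp [zeroExtend]

lemma map_zeroExtend (g : R →+* S) (x : Fin n → R) (k : ℕ) :
    g (zeroExtend x k) = zeroExtend (fun i => g (x i)) k := by
  unfold zeroExtend
  split_ifs <;> simp

lemma map_chainProd (g : R →+* S) (x : Fin n → R) (e k : ℕ) :
    g (chainProd x e k) = chainProd (fun i => g (x i)) e k := by
  simp [chainProd, map_zeroExtend]

lemma map_chainSum (g : R →+* S) (φ : ℕ → R) (e : ℕ) (x : Fin n → R) :
    g (chainSum φ e x) = chainSum (fun i => g (φ i)) e (fun i => g (x i)) := by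
  simp [chainSum, map_chainProd]

@[simp] lemma chainProd_self (x : Fin n → R) (e : ℕ) : chainProd x e e = 1 := by
  simp [chainProd]

lemma chainProd_succ (x : Fin n → R) {e k : ℕ} (h : e ≤ k) :
    chainProd x e (k + 1) = chainProd x e k * zeroExtend x k :=
  Finset.prod_Ico_succ_top h _

lemma chainProd_top (x : Fin n → R) {e : ℕ} (h : e ≤ n) : chainProd x e (n + 1) = 0 := by
  rw [chainProd_succ x h, zeroExtend_self, mul_zero]

lemma chainProd_mul (x : Fin n → R) {e k : ℕ} (h : e ≤ k) :
    chainProd x 0 e * chainProd x e k = chainProd x 0 k :=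
  Finset.prod_Ico_consecutive _ (Nat.zero_le e) h

lemma chainProd_eq_prod (x : Fin n → R) {e : ℕ} (he : e ≤ n) :
    chainProd x 0 e = ∏ i : Fin n, if (i : ℕ) < e then x i else 1 := by
  have : chainProd x 0 e = ∏ l ∈ Finset.range n, if l < e then zeroExtend x l else 1 := by
    rw [chainProd, Finset.prod_ite, Finset.prod_const_one, mul_one]
    refine Finset.prod_congr ?_ fun _ _ => rfl
    ext l
    simp only [Finset.mem_Ico, Finset.mem_filter, Finset.mem_range]
    lia
  rw [this, Finset.prod_range]
  simp

lemma chainSum_one (x : Fin n → R) {e : ℕ} (he : e ≤ n) :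
    ∑ i ∈ Finset.Ico e (n + 1), (chainProd x e i - chainProd x e (i + 1)) = 1 := by
  have := Finset.sum_Ico_sub (fun i => chainProd x e i) (show e ≤ n + 1 by lia)
  simp only [chainProd_self, chainProd_top x he] at this
  rw [← neg_inj, ← Finset.sum_neg_distrib]
  simpa using this

lemma chainSum_zero_eq_mul {φ : ℕ → R} {e : ℕ} (he : e ≤ n) (hφ : ∀ i < e, φ i = 0)
    (x : Fin n → R) : chainSum φ 0 x = chainProd x 0 e * chainSum φ e x := by
  rw [chainSum, chainSum, ← Finset.sum_Ico_consecutive _ (Nat.zero_le e) (show e ≤ n + 1 by lia),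
    Finset.sum_eq_zero, zero_add, Finset.mul_sum]
  · refine Finset.sum_congr rfl fun i hi => ?_
    have hi' := (Finset.mem_Ico.1 hi).1
    rw [← chainProd_mul x hi', ← chainProd_mul x (hi'.trans (Nat.le_succ i))]
    ring
  · intro i hi
    rw [hφ i (Finset.mem_Ico.1 hi).2, mul_zero]

lemma chainSum_zero_eq_add (φ : ℕ → R) (x : Fin n → R) :
    chainSum φ 0 x = φ 0 + ∑ i : Fin n, chainProd x 0 (i + 1) * (φ (i + 1) - φ i) := by
  have key : ∀ (T : ℕ → R) (N : ℕ), ∑ i ∈ Finset.range (N + 1), (T i - T (i + 1)) * φ i =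
      T 0 * φ 0 + ∑ i ∈ Finset.range N, T (i + 1) * (φ (i + 1) - φ i) - T (N + 1) * φ N := by
    intro T N
    induction N with
    | zero => simp; ring
    | succ N ih => rw [Finset.sum_range_succ, ih, Finset.sum_range_succ _ N]; ring
  rw [chainSum, ← Finset.range_eq_Ico, key, chainProd_top x (Nat.zero_le n),
    Finset.sum_range (n := n)]
  simp

lemma zeroExtend_mem_Icc {x : Fin n → ℝ} (hx : x ∈ Set.Icc (0 : Fin n → ℝ) 1) (k : ℕ) :
    zeroExtend x k ∈ Set.Icc (0 : ℝ) 1 := by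
  unfold zeroExtend
  split_ifs with h
  · exact ⟨hx.1 ⟨k, h⟩, hx.2 ⟨k, h⟩⟩
  · simp

lemma chainProd_sub_nonneg {x : Fin n → ℝ} (hx : x ∈ Set.Icc (0 : Fin n → ℝ) 1) {e i : ℕ}
    (hi : e ≤ i) : 0 ≤ chainProd x e i - chainProd x e (i + 1) := by
  rw [chainProd_succ x hi]
  have h0 : 0 ≤ chainProd x e i := Finset.prod_nonneg fun l _ => (zeroExtend_mem_Icc hx l).1
  nlinarith [(zeroExtend_mem_Icc hx i).2]

lemma chainSum_pos {x : Fin n → ℝ} (hx : x ∈ Set.Icc (0 : Fin n → ℝ) 1) {e : ℕ} (he : e ≤ n)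
    {φ : ℕ → ℝ} (hφ : ∀ i, e ≤ i → i ≤ n → 0 < φ i) : 0 < chainSum φ e x := by
  have hpos : ∀ i ∈ Finset.Ico e (n + 1), 0 < φ i := fun i hi =>
    hφ i (Finset.mem_Ico.1 hi).1 (Nat.lt_succ_iff.1 (Finset.mem_Ico.1 hi).2)
  obtain ⟨i, hi, hw⟩ : ∃ i ∈ Finset.Ico e (n + 1),
      0 < chainProd x e i - chainProd x e (i + 1) := by
    by_contra! h
    have := Finset.sum_nonpos h
    rw [chainSum_one x he] at this
    linarith
  exact Finset.sum_pos' (fun j hj => mul_nonneg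
    (chainProd_sub_nonneg hx (Finset.mem_Ico.1 hj).1) (hpos j hj).le)
    ⟨i, hi, mul_pos hw (hpos i hi)⟩

end Chain

section ChainMap

variable {n : ℕ}

lemma chainProd_pos {t : Fin n → ℝ} (ht : ∀ i, t i ∈ Set.Ioo (0 : ℝ) 1) {k : ℕ} (hk : k ≤ n) :
    0 < chainProd t 0 k := by
  rw [chainProd_eq_prod t hk]
  refine Finset.prod_pos fun i _ => ?_
  split_ifs
  · exact (ht i).1
  · exact one_pos

lemma zeroExtend_lt_one {t : Fin n → ℝ} (ht : ∀ i, t i ∈ Set.Ioo (0 : ℝ) 1) (k : ℕ) :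
    zeroExtend t k < 1 := by
  unfold zeroExtend
  split_ifs with h
  · exact (ht ⟨k, h⟩).2
  · exact one_pos

/-- The parametrization of a simplex with vertices `w 0, …, w n` and barycentric coordinates
`c 0, …, c n` by the open unit cube. -/
lemma bijOn_chainSum {w : ℕ → Fin n → ℝ} {c : ℕ → (Fin n → ℝ) → ℝ}
    (hsum : ∀ x, ∑ i ∈ Finset.Ico 0 (n + 1), c i x = 1)
    (hcomb : ∀ x k, ∑ i ∈ Finset.Ico 0 (n + 1), c i x * w i k = x k)
    (hcoord : ∀ a : ℕ → ℝ, ∑ i ∈ Finset.Ico 0 (n + 1), a i = 1 → ∀ l ≤ n,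
      c l (fun k => ∑ i ∈ Finset.Ico 0 (n + 1), a i * w i k) = a l) :
    Set.BijOn (fun (t : Fin n → ℝ) k => chainSum (fun i => w i k) 0 t)
      (Set.univ.pi fun _ => Set.Ioo (0 : ℝ) 1) {x | ∀ l ≤ n, 0 < c l x} := by
  have hc : ∀ (t : Fin n → ℝ), ∀ l ≤ n, c l (fun k => chainSum (fun i => w i k) 0 t) =
      chainProd t 0 l - chainProd t 0 (l + 1) := fun t =>
    hcoord (fun i => chainProd t 0 i - chainProd t 0 (i + 1)) (chainSum_one t (Nat.zero_le n))
  refine ⟨fun t ht l hl => ?_, fun t ht t' ht' h => ?_, fun x hx => ?_⟩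
  · rw [hc t l hl, chainProd_succ t (Nat.zero_le l)]
    rw [Set.mem_univ_pi] at ht
    have h1 := chainProd_pos ht hl
    have h2 := zeroExtend_lt_one ht l
    nlinarith
  · rw [Set.mem_univ_pi] at ht ht'
    have hk : ∀ k ≤ n, chainProd t 0 k = chainProd t' 0 k := by
      intro k
      induction k with
      | zero => simp
      | succ k ih =>
        intro hk
        have h1 := hc t k (by lia)
        have h2 := hc t' k (by lia)
        simp only at h
        rw [h, h2, ih (by lia)] at h1
        linarith
    ext i
    have h1 := hk (i + 1) i.2
    rw [chainProd_succ t (Nat.zero_le _), chainProd_succ t' (Nat.zero_le _), zeroExtend_val,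
      zeroExtend_val, hk i i.2.le] at h1
    exact mul_left_cancel₀ (chainProd_pos ht' i.2.le).ne' h1
  · set T : ℕ → ℝ := fun k => ∑ i ∈ Finset.Ico k (n + 1), c i x with hT
    have hTpos : ∀ k ≤ n, 0 < T k := fun k hk => Finset.sum_pos
      (fun i hi => hx i (Nat.lt_succ_iff.1 (Finset.mem_Ico.1 hi).2))
      ⟨k, Finset.mem_Ico.2 ⟨le_rfl, Nat.lt_succ_iff.2 hk⟩⟩
    have hTsucc : ∀ k ≤ n, T k = c k x + T (k + 1) := fun k hk =>
      Finset.sum_eq_sum_Ico_succ_bot (Nat.lt_succ_iff.2 hk) _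
    set t : Fin n → ℝ := fun l => T (l + 1) / T l with ht
    have htT : ∀ k ≤ n, chainProd t 0 k = T k := by
      intro k
      induction k with
      | zero => exact fun _ => (chainProd_self t 0).trans (hsum x).symm
      | succ k ih =>
        intro hk
        have h := zeroExtend_val t ⟨k, hk⟩
        simp only at h
        rw [chainProd_succ t (Nat.zero_le k), ih (by lia), h]
        exact mul_div_cancel₀ _ (hTpos k (by lia)).ne'
    have htT' : ∀ k ≤ n, chainProd t 0 (k + 1) = T (k + 1) := by
      intro k hk
      rcases hk.eq_or_lt with rfl | hk
      · rw [chainProd_top t (Nat.zero_le _)]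
        simp [hT]
      · exact htT _ hk
    refine ⟨t, ?_, ?_⟩
    · rw [Set.mem_univ_pi]
      intro i
      have h0 := hTpos i i.2.le
      have h1 := hTpos (i + 1) i.2
      refine ⟨div_pos h1 h0, (div_lt_one h0).2 ?_⟩
      rw [hTsucc i i.2.le]
      linarith [hx i i.2.le]
    · ext k
      rw [← hcomb x k]
      refine Finset.sum_congr rfl fun i hi => ?_
      have hi' : i ≤ n := Nat.lt_succ_iff.1 (Finset.mem_Ico.1 hi).2
      rw [htT i hi', htT' i hi', hTsucc i hi', add_sub_cancel_right]

/-- The Jacobian matrix of the partial product map. -/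
noncomputable def chainJacobian (t : Fin n → ℝ) : Matrix (Fin n) (Fin n) ℝ :=
  Matrix.of fun i l => if l ≤ i then ∏ p ∈ (Finset.Iic i).erase l, t p else 0

lemma det_chainJacobian (t : Fin n → ℝ) :
    (chainJacobian t).det = ∏ i, t i ^ (n - 1 - (i : ℕ)) := by
  rw [Matrix.det_of_isLowerTriangular]
  · have h : ∀ i : Fin n, chainJacobian t i i = ∏ p ∈ Finset.Iio i, t p := by
      intro i
      simp [chainJacobian, Finset.Iic_erase]
    simp only [h]
    rw [Finset.prod_comm' (t' := Finset.univ) (s' := fun p => Finset.Ioi p) (by simp)]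
    simp [Fin.card_Ioi]
  · intro i l hil
    simp only [OrderDual.toDual_lt_toDual] at hil
    simp [chainJacobian, hil.not_ge]

lemma hasFDerivAt_chainProd (t : Fin n → ℝ) :
    HasFDerivAt (fun (t : Fin n → ℝ) (i : Fin n) => chainProd t 0 (i + 1))
      (LinearMap.toContinuousLinearMap (Matrix.toLin' (chainJacobian t))) t := by
  rw [hasFDerivAt_pi']
  intro i
  have h : ∀ t : Fin n → ℝ, chainProd t 0 (i + 1) = ∏ p ∈ Finset.Iic i, t p := by
    intro t
    rw [chainProd_eq_prod t i.2, Finset.prod_ite, Finset.prod_const_one, mul_one]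
    refine Finset.prod_congr ?_ fun _ _ => rfl
    ext p
    simp
  simp only [h]
  refine (hasFDerivAt_finsetProd (u := Finset.Iic i) (x := t)).congr_fderiv ?_
  ext y
  simp only [chainJacobian, ContinuousLinearMap.coe_comp, Function.comp_apply,
    LinearMap.coe_toContinuousLinearMap', ContinuousLinearMap.proj_apply, Matrix.toLin'_apply,
    Matrix.mulVec, dotProduct, Matrix.of_apply, ite_mul, zero_mul]
  rw [← Finset.sum_filter]
  simp only [sum_apply, smul_apply, ContinuousLinearMap.proj_apply, smul_eq_mul]
  exact Finset.sum_congr (by ext; simp) fun _ _ => rfl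

end ChainMap

section ChangeOfVariables

variable {n : ℕ}

lemma unitCubeMeasure_eq_restrict_Ioo (n : ℕ) :
    unitCubeMeasure n = volume.restrict (Set.univ.pi fun _ : Fin n => Set.Ioo (0 : ℝ) 1) := by
  rw [unitCubeMeasure_eq_restrict]
  refine Measure.restrict_congr_set ?_
  exact (Measure.univ_pi_Ioc_ae_eq_Icc (μ := fun _ : Fin n => (volume : Measure ℝ))
    (f := fun _ => 0) (g := fun _ => 1)).trans
    (Measure.univ_pi_Ioo_ae_eq_Icc (μ := fun _ : Fin n => (volume : Measure ℝ))
    (f := fun _ => 0) (g := fun _ => 1)).symm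

/-- The matrix of edge vectors of a chain of points. -/
def edgeMatrix {R : Type*} [Ring R] (w : ℕ → Fin n → R) : Matrix (Fin n) (Fin n) R :=
  Matrix.of fun k i => w (i + 1) k - w i k

lemma hasFDerivAt_chainSum (w : ℕ → Fin n → ℝ) (t : Fin n → ℝ) :
    HasFDerivAt (fun (t : Fin n → ℝ) k => chainSum (fun i => w i k) 0 t)
      (LinearMap.toContinuousLinearMap (Matrix.toLin' (edgeMatrix w * chainJacobian t))) t := by
  have h : (fun (t : Fin n → ℝ) k => chainSum (fun i => w i k) 0 t) = fun t =>
      w 0 + LinearMap.toContinuousLinearMap (Matrix.toLin' (edgeMatrix w))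
        (fun i => chainProd t 0 (i + 1)) := by
    ext t k
    simp [chainSum_zero_eq_add, edgeMatrix, Matrix.mulVec, dotProduct, mul_comm]
  rw [h]
  refine HasFDerivAt.const_add _ ?_
  refine ((LinearMap.toContinuousLinearMap (Matrix.toLin' (edgeMatrix w))).hasFDerivAt.comp t
    (hasFDerivAt_chainProd t)).congr_fderiv ?_
  ext y
  simp [Matrix.toLin'_mul]

lemma abs_det_fderiv_chainSum (w : ℕ → Fin n → ℝ) {t : Fin n → ℝ}
    (ht : t ∈ Set.univ.pi fun _ : Fin n => Set.Ioo (0 : ℝ) 1) :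
    |(LinearMap.toContinuousLinearMap
      (Matrix.toLin' (edgeMatrix w * chainJacobian t)) : (Fin n → ℝ) →L[ℝ] (Fin n → ℝ)).det| =
      |(edgeMatrix w).det| * ∏ i, t i ^ (n - 1 - (i : ℕ)) := by
  rw [Set.mem_univ_pi] at ht
  rw [LinearMap.det_toContinuousLinearMap, LinearMap.det_toLin', Matrix.det_mul, abs_mul,
    det_chainJacobian, abs_of_nonneg (a := ∏ i, t i ^ (n - 1 - (i : ℕ)))]
  exact Finset.prod_nonneg fun i _ => pow_nonneg (ht i).1.le _

variable {w : ℕ → Fin n → ℝ} {O : Set (Fin n → ℝ)}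

lemma integral_eq_integral_chainSum
    (hO : Set.BijOn (fun (t : Fin n → ℝ) k => chainSum (fun i => w i k) 0 t)
      (Set.univ.pi fun _ => Set.Ioo (0 : ℝ) 1) O) (h : (Fin n → ℝ) → ℂ) :
    ∫ x in O, h x = ∫ t, (|(edgeMatrix w).det| * ∏ i, t i ^ (n - 1 - (i : ℕ)) : ℝ) •
      h (fun k => chainSum (fun i => w i k) 0 t) ∂unitCubeMeasure n := by
  have hms : MeasurableSet (Set.univ.pi fun _ : Fin n => Set.Ioo (0 : ℝ) 1) :=
    MeasurableSet.univ_pi fun _ => measurableSet_Ioo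
  rw [unitCubeMeasure_eq_restrict_Ioo, ← hO.image_eq,
    integral_image_eq_integral_abs_det_fderiv_smul volume hms
      (fun t _ => (hasFDerivAt_chainSum w t).hasFDerivWithinAt) hO.injOn]
  exact setIntegral_congr_fun hms fun t ht => by simp only [abs_det_fderiv_chainSum w ht]

lemma integrableOn_iff_integrable_chainSum
    (hO : Set.BijOn (fun (t : Fin n → ℝ) k => chainSum (fun i => w i k) 0 t)
      (Set.univ.pi fun _ => Set.Ioo (0 : ℝ) 1) O) (h : (Fin n → ℝ) → ℂ) :
    IntegrableOn h O ↔ Integrable (fun t : Fin n → ℝ =>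
      (|(edgeMatrix w).det| * ∏ i, t i ^ (n - 1 - (i : ℕ)) : ℝ) •
        h (fun k => chainSum (fun i => w i k) 0 t)) (unitCubeMeasure n) := by
  have hms : MeasurableSet (Set.univ.pi fun _ : Fin n => Set.Ioo (0 : ℝ) 1) :=
    MeasurableSet.univ_pi fun _ => measurableSet_Ioo
  rw [unitCubeMeasure_eq_restrict_Ioo, ← hO.image_eq,
    integrableOn_image_iff_integrableOn_abs_det_fderiv_smul volume hms
      (fun t _ => (hasFDerivAt_chainSum w t).hasFDerivWithinAt) hO.injOn]
  exact integrableOn_congr_fun (fun t ht => by simp only [abs_det_fderiv_chainSum w ht]) hms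

end ChangeOfVariables

section PrefixAverage

variable {K : Type*} [Field K] {N : ℕ}

/-- The average of the first `i + 1` terms of a finite sequence. -/
def prefixAverage (y : Fin N → K) (i : ℕ) : K :=
  (i + 1 : K)⁻¹ * ∑ p ∈ Finset.range (i + 1), zeroExtend y p

lemma map_prefixAverage {L : Type*} [Field L] (g : K →+* L) (y : Fin N → K) (i : ℕ) :
    g (prefixAverage y i) = prefixAverage (fun p => g (y p)) i := by
  simp [prefixAverage, map_zeroExtend]

lemma prefixAverage_one [CharZero K] {i : ℕ} (hi : i < N) :
    prefixAverage (fun _ : Fin N => (1 : K)) i = 1 := by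
  have h : ∀ p ∈ Finset.range (i + 1), zeroExtend (fun _ : Fin N => (1 : K)) p = 1 := by
    intro p hp
    rw [Finset.mem_range] at hp
    simp [zeroExtend, show p < N by omega]
  rw [prefixAverage, Finset.sum_congr rfl h]
  have : (i + 1 : K) ≠ 0 := by exact_mod_cast i.succ_ne_zero
  simp [this]

/-- Summation by parts for prefix averages. -/
lemma sum_sub_mul_prefixAverage [CharZero K] (μ y : Fin N → K) :
    ∑ i ∈ Finset.range N, ((i + 1 : K) * (zeroExtend μ i - zeroExtend μ (i + 1))) *
      prefixAverage y i = ∑ p, μ p * y p := by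
  have key : ∀ M : ℕ, ∑ i ∈ Finset.range M,
      ((i + 1 : K) * (zeroExtend μ i - zeroExtend μ (i + 1))) * prefixAverage y i =
      ∑ i ∈ Finset.range M, zeroExtend μ i * zeroExtend y i -
        zeroExtend μ M * ∑ i ∈ Finset.range M, zeroExtend y i := by
    intro M
    induction M with
    | zero => simp
    | succ M ih =>
      rw [Finset.sum_range_succ, ih, prefixAverage]
      have : (M + 1 : K) ≠ 0 := by exact_mod_cast M.succ_ne_zero
      field_simp
      simp only [Finset.sum_range_succ]
      ring
  rw [key, zeroExtend_self, zero_mul, sub_zero, Finset.sum_range]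
  simp

lemma prefixAverage_indicator (l : Fin N) (i : ℕ) :
    prefixAverage (fun p => if p = l then (1 : K) else 0) i =
      if (l : ℕ) ≤ i then (i + 1 : K)⁻¹ else 0 := by
  have h : ∀ p ∈ Finset.range (i + 1),
      zeroExtend (fun p => if p = l then (1 : K) else 0) p = if p = (l : ℕ) then 1 else 0 := by
    intro p _
    by_cases hp : p < N
    · simp [zeroExtend, hp, Fin.ext_iff]
    · have : p ≠ l := by have := l.2; omega
      simp [zeroExtend, hp, this]
  rw [prefixAverage, Finset.sum_congr rfl h, Finset.sum_ite_eq']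
  simp

lemma AffineMap.map_sum_mul {ι : Type*} {n : ℕ} (g : (Fin n → ℝ) →ᵃ[ℝ] ℝ) (s : Finset ι)
    (a : ι → ℝ) (ha : ∑ i ∈ s, a i = 1) (w : ι → Fin n → ℝ) :
    g (fun k => ∑ i ∈ s, a i * w i k) = ∑ i ∈ s, a i * g (w i) := by
  have h := s.map_affineCombination w a ha g
  rw [s.affineCombination_eq_linear_combination _ _ ha,
    s.affineCombination_eq_linear_combination _ _ ha] at h
  simp only [Function.comp_apply, smul_eq_mul] at h
  rw [← h]
  congr 1
  ext k
  simp

lemma AffineMap.map_prefixAverage {n : ℕ} (g : (Fin n → ℝ) →ᵃ[ℝ] ℝ)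
    (v : Fin N → Fin n → ℝ) {i : ℕ} (hi : i < N) :
    g (fun k => prefixAverage (fun p => v p k) i) = prefixAverage (fun p => g (v p)) i := by
  have h := g.map_sum_mul (Finset.range (i + 1)) (fun _ => (i + 1 : ℝ)⁻¹)
    (by
      have : (i + 1 : ℝ) ≠ 0 := by exact_mod_cast i.succ_ne_zero
      simp [this]) (fun p k => zeroExtend (fun p => v p k) p)
  simp only [← Finset.mul_sum] at h
  rw [prefixAverage]
  refine h.trans ?_
  congr 1
  refine Finset.sum_congr rfl fun p hp => ?_
  rw [Finset.mem_range] at hp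
  simp [zeroExtend, show p < N by omega]

end PrefixAverage

section Sector

variable {n : ℕ} (b : AffineBasis (Fin (n + 1)) ℝ (Fin n → ℝ)) (σ : Equiv.Perm (Fin (n + 1)))

/-- The open cell of the barycentric subdivision of a simplex in which the barycentric
coordinates are positive and ordered according to `σ`. -/
def barycentricSector : Set (Fin n → ℝ) :=
  {x | ∀ l ≤ n, 0 < (l + 1 : ℝ) * (zeroExtend (fun p => b.coord (σ p) x) l -
    zeroExtend (fun p => b.coord (σ p) x) (l + 1))}

/-- The vertices of a cell of the barycentric subdivision. -/
def sectorVertex {K : Type*} [Field K] (v : Fin (n + 1) → Fin n → K)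
    (σ : Equiv.Perm (Fin (n + 1))) (i : ℕ) (k : Fin n) : K :=
  prefixAverage (fun p => v (σ p) k) i

lemma zeroExtend_coord_sum (a : ℕ → ℝ) (ha : ∑ i ∈ Finset.Ico 0 (n + 1), a i = 1) (l : ℕ) :
    zeroExtend (fun p => b.coord (σ p)
      (fun k => ∑ i ∈ Finset.Ico 0 (n + 1), a i * sectorVertex b σ i k)) l =
      ∑ i ∈ Finset.Ico l (n + 1), a i * (i + 1 : ℝ)⁻¹ := by
  by_cases hl : l < n + 1
  · simp only [zeroExtend, hl, dite_true]
    rw [AffineMap.map_sum_mul _ _ _ ha]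
    have h : ∀ i ∈ Finset.Ico 0 (n + 1), a i * b.coord (σ ⟨l, hl⟩) (sectorVertex b σ i) =
        if l ≤ i then a i * (i + 1 : ℝ)⁻¹ else 0 := by
      intro i hi
      rw [Finset.mem_Ico] at hi
      have := AffineMap.map_prefixAverage (b.coord (σ ⟨l, hl⟩)) (fun p => b (σ p)) hi.2
      unfold sectorVertex
      rw [this]
      have h2 : (fun p => b.coord (σ ⟨l, hl⟩) (b (σ p))) =
          fun p => if p = ⟨l, hl⟩ then (1 : ℝ) else 0 := by
        ext p
        simp [AffineBasis.coord_apply, eq_comm]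
      rw [h2, prefixAverage_indicator]
      simp
    rw [Finset.sum_congr rfl h, ← Finset.sum_filter]
    congr 1
    ext i
    simp [and_comm]
  · simp [zeroExtend, hl, Finset.Ico_eq_empty (show ¬ l < n + 1 from hl)]

lemma bijOn_sector :
    Set.BijOn (fun (t : Fin n → ℝ) k => chainSum (fun i => sectorVertex b σ i k) 0 t)
      (Set.univ.pi fun _ => Set.Ioo 0 1) (barycentricSector b σ) := by
  refine bijOn_chainSum (w := sectorVertex b σ)
    (c := fun l x => (l + 1 : ℝ) * (zeroExtend (fun p => b.coord (σ p) x) l -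
      zeroExtend (fun p => b.coord (σ p) x) (l + 1))) ?_ ?_ ?_
  · intro x
    have h := sum_sub_mul_prefixAverage (fun p => b.coord (σ p) x) (fun _ => (1 : ℝ))
    rw [Equiv.sum_comp σ (fun p => b.coord p x * 1)] at h
    simp only [mul_one, b.sum_coord_apply_eq_one] at h
    rw [Finset.range_eq_Ico] at h
    refine Eq.trans (Finset.sum_congr rfl fun i hi => ?_) h
    rw [prefixAverage_one (Finset.mem_Ico.1 hi).2, mul_one]
  · intro x k
    have h := sum_sub_mul_prefixAverage (fun p => b.coord (σ p) x) (fun p => b (σ p) k)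
    rw [Equiv.sum_comp σ (fun p => b.coord p x * b p k)] at h
    rw [Finset.range_eq_Ico] at h
    refine h.trans ?_
    have := congrFun (b.linear_combination_coord_eq_self x) k
    simpa using this
  · intro a ha l hl
    rw [zeroExtend_coord_sum b σ a ha, zeroExtend_coord_sum b σ a ha,
      Finset.sum_eq_sum_Ico_succ_bot (by omega : l < n + 1)]
    have : (l + 1 : ℝ) ≠ 0 := by exact_mod_cast l.succ_ne_zero
    field_simp
    ring

lemma mem_barycentricSector_iff {x : Fin n → ℝ} :
    x ∈ barycentricSector b σ ↔
      StrictAnti (fun p => b.coord (σ p) x) ∧ ∀ p, 0 < b.coord p x := by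
  have hpos : ∀ l : ℕ, (0 : ℝ) < l + 1 := fun l => by positivity
  constructor
  · intro h
    have hstep : ∀ l ≤ n, zeroExtend (fun p => b.coord (σ p) x) (l + 1) <
        zeroExtend (fun p => b.coord (σ p) x) l := fun l hl =>
      sub_pos.1 ((mul_pos_iff_of_pos_left (hpos l)).1 (h l hl))
    have hanti : StrictAnti (fun p => b.coord (σ p) x) := by
      refine Fin.strictAnti_iff_succ_lt.2 fun i => ?_
      have := hstep i i.2.le
      simpa [zeroExtend, Fin.succ, Fin.castSucc, Fin.castAdd, Fin.castLE,
        show (i : ℕ) < n + 1 by omega] using this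
    refine ⟨hanti, fun p => ?_⟩
    have hlast : 0 < b.coord (σ (Fin.last n)) x := by
      have := hstep n le_rfl
      simpa [zeroExtend, Fin.last] using this
    have := hanti.antitone (Fin.le_last (σ.symm p))
    simp only [Equiv.apply_symm_apply] at this
    exact hlast.trans_le this
  · rintro ⟨hanti, hp⟩ l hl
    refine mul_pos (hpos l) (sub_pos.2 ?_)
    rcases hl.lt_or_eq with h | rfl
    · simp only [zeroExtend, show l < n + 1 by omega, show l + 1 < n + 1 by omega, dite_true]
      exact hanti (by simp [Fin.lt_def])
    · simp [zeroExtend, hp]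

lemma measurableSet_barycentricSector : MeasurableSet (barycentricSector b σ) := by
  have h : barycentricSector b σ = ⋂ l ∈ Set.Iic n, {x | 0 < (l + 1 : ℝ) *
      (zeroExtend (fun p => b.coord (σ p) x) l -
        zeroExtend (fun p => b.coord (σ p) x) (l + 1))} := by
    ext x
    simp [barycentricSector]
  have hc : ∀ l : ℕ, Continuous fun x => zeroExtend (fun p => b.coord (σ p) x) l := by
    intro l
    unfold zeroExtend
    split_ifs with hl
    · exact (b.coord _).continuous_of_finiteDimensional
    · exact continuous_const
  rw [h]
  refine MeasurableSet.biInter (Set.to_countable _) fun l _ => ?_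
  exact (isOpen_lt continuous_const
    (continuous_const.mul ((hc l).sub (hc (l + 1))))).measurableSet

lemma pairwise_disjoint_barycentricSector :
    Pairwise (Function.onFun Disjoint (barycentricSector b)) := by
  intro σ τ hne
  refine Set.disjoint_left.2 fun x hx hy => hne ?_
  have h1 := ((mem_barycentricSector_iff b σ).1 hx).1
  have h2 := ((mem_barycentricSector_iff b τ).1 hy).1
  have hinj : Function.Injective fun p => b.coord p x := by
    intro p q hpq
    have := h1.injective (a₁ := σ.symm p) (a₂ := σ.symm q) (by simpa using hpq)
    simpa using this
  have hmono : StrictMono (σ.symm * τ) := by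
    intro p q hpq
    have := h2 hpq
    rw [← h1.lt_iff_gt]
    simpa using this
  have := Subsingleton.elim (hmono.orderIsoOfSurjective _ (Equiv.surjective _))
    (OrderIso.refl (Fin (n + 1)))
  ext p
  have h3 := congrArg (fun e : Fin (n + 1) ≃o Fin (n + 1) => σ (e p)) this
  simp at h3
  rw [h3]

lemma barycentricSector_subset : barycentricSector b σ ⊆ convexHull ℝ (Set.range b) := by
  intro x hx
  rw [b.convexHull_eq_nonneg_coord]
  exact fun p => (((mem_barycentricSector_iff b σ).1 hx).2 p).le

lemma volume_setOf_affineMap_eq_zero (g : (Fin n → ℝ) →ᵃ[ℝ] ℝ) (hg : ∃ x, g x ≠ 0) :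
    volume {x | g x = 0} = 0 := by
  have h : {x | g x = 0} =
      ((AffineSubspace.mk' (0 : ℝ) (⊥ : Submodule ℝ ℝ)).comap g : Set (Fin n → ℝ)) := by
    ext x
    simp [AffineSubspace.mem_mk']
  rw [h]
  refine Measure.addHaar_affineSubspace _ _ ?_
  intro htop
  obtain ⟨x, hx⟩ := hg
  have : x ∈ (AffineSubspace.mk' (0 : ℝ) (⊥ : Submodule ℝ ℝ)).comap g := htop ▸ trivial
  simp [AffineSubspace.mem_mk'] at this
  exact hx this

lemma iUnion_barycentricSector_ae_eq :
    (⋃ σ, barycentricSector b σ : Set (Fin n → ℝ)) =ᵐ[volume] convexHull ℝ (Set.range b) := by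
  have h0 : ∀ᵐ x : Fin n → ℝ, ∀ p, b.coord p x ≠ 0 := by
    refine ae_all_iff.2 fun p => ?_
    rw [ae_iff]
    simpa using volume_setOf_affineMap_eq_zero (b.coord p) ⟨b p, by simp⟩
  have h1 : ∀ᵐ x : Fin n → ℝ, ∀ p q, p ≠ q → b.coord p x ≠ b.coord q x := by
    refine ae_all_iff.2 fun p => ae_all_iff.2 fun q => ?_
    by_cases hpq : p = q
    · simp [hpq]
    · rw [ae_iff]
      have := volume_setOf_affineMap_eq_zero (b.coord p - b.coord q)
        ⟨b p, by simp [Ne.symm hpq]⟩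
      simpa [hpq, sub_eq_zero] using this
  rw [eventuallyEq_set]
  filter_upwards [h0, h1] with x hx0 hx1
  constructor
  · intro hx
    obtain ⟨σ, hσ⟩ := Set.mem_iUnion.1 hx
    exact barycentricSector_subset b σ hσ
  · intro hx
    rw [b.convexHull_eq_nonneg_coord] at hx
    refine Set.mem_iUnion.2 ⟨Tuple.sort fun p => -b.coord p x, ?_⟩
    rw [mem_barycentricSector_iff]
    refine ⟨?_, fun p => lt_of_le_of_ne (hx p) (hx0 p).symm⟩
    have hm := Tuple.monotone_sort fun p => -b.coord p x
    intro p q hpq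
    have hle := hm hpq.le
    simp only [Function.comp_apply, neg_le_neg_iff] at hle
    exact lt_of_le_of_ne hle (hx1 _ _ fun h => hpq.ne' ((Equiv.injective _) h))

lemma setIntegral_convexHull_eq_sum (h : (Fin n → ℝ) → ℂ)
    (hh : ∀ σ, IntegrableOn h (barycentricSector b σ)) :
    ∫ x in convexHull ℝ (Set.range b), h x = ∑ σ, ∫ x in barycentricSector b σ, h x := by
  rw [← setIntegral_congr_set (iUnion_barycentricSector_ae_eq b)]
  exact integral_iUnion_fintype (measurableSet_barycentricSector b)
    (pairwise_disjoint_barycentricSector b) hh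

end Sector

section AffineForms

variable {n : ℕ}

lemma exists_forall_lt_prefixAverage_eq_zero {N : ℕ} (y : Fin (N + 1) → ℚ)
    (hy : ∀ p, 0 ≤ y p) (hpos : ∃ p, 0 < y p) :
    ∃ e ≤ N, (∀ i < e, prefixAverage y i = 0) ∧ ∀ i, e ≤ i → i ≤ N → 0 < prefixAverage y i := by
  have hex : ∃ p, 0 < zeroExtend y p := by
    obtain ⟨p, hp⟩ := hpos
    exact ⟨p, by simpa using hp⟩
  have hnn : ∀ p, 0 ≤ zeroExtend y p := by
    intro p
    unfold zeroExtend
    split_ifs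
    · exact hy _
    · exact le_rfl
  refine ⟨Nat.find hex, ?_, fun i hi => ?_, fun i hi hin => ?_⟩
  · by_contra h
    have := Nat.find_spec hex
    rw [zeroExtend, dif_neg (by omega)] at this
    exact this.false
  · rw [prefixAverage, Finset.sum_eq_zero, mul_zero]
    intro p hp
    rw [Finset.mem_range] at hp
    exact le_antisymm (not_lt.1 (Nat.find_min hex (by omega))) (hnn p)
  · refine mul_pos (by positivity) ?_
    exact Finset.sum_pos' (fun p _ => hnn p)
      ⟨Nat.find hex, Finset.mem_range.2 (by omega), Nat.find_spec hex⟩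

variable (b : AffineBasis (Fin (n + 1)) ℝ (Fin n → ℝ)) (g : (Fin n → ℝ) →ᵃ[ℝ] ℝ)

lemma AffineMap.nonneg_of_pos_on_interior_convexHull
    (hg : ∀ x ∈ interior (convexHull ℝ (Set.range b)), 0 < g x) (p : Fin (n + 1)) :
    0 ≤ g (b p) := by
  have hne : (interior (convexHull ℝ (Set.range b))).Nonempty :=
    ⟨_, b.centroid_mem_interior_convexHull⟩
  have hcl := (convex_convexHull ℝ (Set.range b)).closure_interior_eq_closure_of_nonempty_interior
    hne
  have hmem : b p ∈ closure (interior (convexHull ℝ (Set.range b))) :=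
    hcl ▸ subset_closure (subset_convexHull ℝ _ ⟨p, rfl⟩)
  exact closure_minimal (t := {x | 0 ≤ g x}) (fun x hx => (hg x hx).le)
    (isClosed_le continuous_const g.continuous_of_finiteDimensional) hmem

lemma AffineMap.exists_pos_of_pos_on_interior_convexHull
    (hg : ∀ x ∈ interior (convexHull ℝ (Set.range b)), 0 < g x) : ∃ p, 0 < g (b p) := by
  by_contra! h
  have hzero : ∀ p, g (b p) = 0 := fun p =>
    le_antisymm (h p) (g.nonneg_of_pos_on_interior_convexHull b hg p)
  have hx := hg _ b.centroid_mem_interior_convexHull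
  set x := Finset.univ.centroid ℝ b
  have hcomb := g.map_sum_mul Finset.univ (fun p => b.coord p x) (b.sum_coord_apply_eq_one x) b
  have hself : (fun k => ∑ p, b.coord p x * b p k) = x := by
    ext k
    simpa using congrFun (b.linear_combination_coord_eq_self x) k
  rw [hself] at hcomb
  simp [hcomb, hzero] at hx

lemma chainSum_sectorVertex_mem {t : Fin n → ℝ} (ht : t ∈ Set.Icc 0 1)
    (σ : Equiv.Perm (Fin (n + 1))) :
    (fun k => chainSum (fun i => sectorVertex b σ i k) 0 t) ∈ convexHull ℝ (Set.range b) := by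
  rw [b.convexHull_eq_nonneg_coord]
  intro p
  have hsum := chainSum_one t (Nat.zero_le n)
  have h := zeroExtend_coord_sum b σ (fun i => chainProd t 0 i - chainProd t 0 (i + 1))
    hsum (σ.symm p)
  rw [zeroExtend_val] at h
  simp only [Equiv.apply_symm_apply] at h
  simp only [chainSum]
  rw [h]
  exact Finset.sum_nonneg fun i hi => mul_nonneg (chainProd_sub_nonneg ht (Nat.zero_le i))
    (by positivity)

lemma AffineMap.map_chainSum_sectorVertex (v : Fin (n + 1) → Fin n → ℝ)
    (σ : Equiv.Perm (Fin (n + 1))) (t : Fin n → ℝ) :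
    g (fun k => chainSum (fun i => sectorVertex v σ i k) 0 t) =
      chainSum (prefixAverage fun p => g (v (σ p))) 0 t := by
  have hsum := chainSum_one t (Nat.zero_le n)
  simp only [chainSum]
  rw [g.map_sum_mul _ _ hsum]
  refine Finset.sum_congr rfl fun i hi => ?_
  rw [← g.map_prefixAverage (fun p => v (σ p)) (Finset.mem_Ico.1 hi).2]
  rfl

end AffineForms

section SectorDensity

variable {n k : ℕ}

lemma analyticAt_chainSum (φ : ℕ → ℂ) (e : ℕ) (z : Fin n → ℂ) :
    AnalyticAt ℂ (fun z : Fin n → ℂ => chainSum φ e z) z := by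
  have hz : ∀ l, AnalyticAt ℂ (fun z : Fin n → ℂ => zeroExtend z l) z := by
    intro l
    unfold zeroExtend
    split_ifs
    · exact (ContinuousLinearMap.proj (R := ℂ) (φ := fun _ : Fin n => ℂ) _).analyticAt z
    · exact analyticAt_const
  have hp : ∀ i, AnalyticAt ℂ (fun z : Fin n → ℂ => chainProd z e i) z := fun i =>
    Finset.analyticAt_fun_prod _ fun l _ => hz l
  exact Finset.analyticAt_fun_sum _ fun i _ => ((hp i).sub (hp (i + 1))).mul analyticAt_const

lemma ofReal_chainSum_ratCast (φ : ℕ → ℚ) (e : ℕ) (t : Fin n → ℝ) :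
    chainSum (fun i => (φ i : ℂ)) e (fun i => (t i : ℂ)) =
      (chainSum (fun i => (φ i : ℝ)) e t : ℝ) := by
  have := map_chainSum (algebraMap ℝ ℂ) (fun i => (φ i : ℝ)) e t
  simpa using this.symm

/-- The analytic factor of the integrand in the coordinates of a sector. -/
noncomputable def sectorDensity (w : ℕ → Fin n → ℚ) (φ : Fin k → ℕ → ℚ) (e : Fin k → ℕ)
    (E : ℂ × (Fin n → ℂ) → ℂ) (p : ℂ × (Fin n → ℂ)) : ℂ :=
  ((|(edgeMatrix w).det| : ℚ) : ℂ) *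
    (∏ j, chainSum (fun i => (φ j i : ℂ)) (e j) p.2 ^ p.1) *
    E (p.1, fun l => chainSum (fun i => (w i l : ℂ)) 0 p.2)

variable {w : ℕ → Fin n → ℚ} {φ : Fin k → ℕ → ℚ} {e : Fin k → ℕ} {E : ℂ × (Fin n → ℂ) → ℂ}
  {V : Set (Fin n → ℝ)}

lemma chainSum_ratCast_pos {ψ : ℕ → ℚ} {d : ℕ} (hd : d ≤ n)
    (hψ : ∀ i, d ≤ i → i ≤ n → 0 < ψ i) {t : Fin n → ℝ} (ht : t ∈ Set.Icc 0 1) :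
    0 < chainSum (fun i => (ψ i : ℝ)) d t :=
  chainSum_pos ht hd fun i h1 h2 => by exact_mod_cast hψ i h1 h2

lemma analyticOnUnitCube_sectorDensity (he : ∀ j, e j ≤ n)
    (hφ : ∀ j i, e j ≤ i → i ≤ n → 0 < φ j i)
    (hw : ∀ t ∈ Set.Icc (0 : Fin n → ℝ) 1, (fun l => chainSum (fun i => (w i l : ℝ)) 0 t) ∈ V)
    (hE : ∀ s : ℂ, ∀ x ∈ V, AnalyticAt ℂ E (s, fun i => (x i : ℂ))) :
    AnalyticOnUnitCube (sectorDensity w φ e E) := by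
  intro s t ht
  have hcs : ∀ (ψ : ℕ → ℂ) (d : ℕ), AnalyticAt ℂ
      (fun p : ℂ × (Fin n → ℂ) => chainSum ψ d p.2) (s, fun i => (t i : ℂ)) := fun ψ d =>
    (analyticAt_chainSum ψ d _).comp (f := Prod.snd) analyticAt_snd
  refine (analyticAt_const.mul (Finset.analyticAt_fun_prod _ fun j _ => ?_)).mul ?_
  · refine (hcs _ _).cpow analyticAt_fst ?_
    simp only [ofReal_chainSum_ratCast]
    exact Complex.ofReal_mem_slitPlane.2 (chainSum_ratCast_pos (he j) (hφ j) ht)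
  · refine AnalyticAt.comp (g := E) (f := fun p : ℂ × (Fin n → ℂ) =>
      (p.1, fun l => chainSum (fun i => (w i l : ℂ)) 0 p.2)) ?_ ?_
    · simp only [ofReal_chainSum_ratCast]
      exact hE s _ (hw t ht)
    · exact analyticAt_fst.prod (AnalyticAt.pi fun l => hcs _ _)

/-- The polynomial whose evaluation is `chainSum`. -/
noncomputable def chainSumPoly (n : ℕ) (φ : ℕ → ℚ) (e : ℕ) : MvPolynomial (Fin n) ℚ :=
  chainSum (fun i => MvPolynomial.C (φ i)) e MvPolynomial.X

lemma eval_map_chainSumPoly (φ : ℕ → ℚ) (e : ℕ) (z : Fin n → ℂ) :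
    MvPolynomial.eval z (MvPolynomial.map (algebraMap ℚ ℂ) (chainSumPoly n φ e)) =
      chainSum (fun i => (φ i : ℂ)) e z := by
  rw [chainSumPoly, map_chainSum (MvPolynomial.map (algebraMap ℚ ℂ)),
    map_chainSum (MvPolynomial.eval z)]
  simp

lemma coeff_zero_chainSumPoly_pos {ψ : ℕ → ℚ} {d : ℕ} (hd : d ≤ n)
    (hψ : ∀ i, d ≤ i → i ≤ n → 0 < ψ i) : 0 < (chainSumPoly n ψ d).coeff 0 := by
  have h := chainSum_ratCast_pos hd hψ (t := 0) (by simp)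
  have h2 := eval_map_chainSumPoly ψ d (fun i : Fin n => (((0 : Fin n → ℝ) i : ℝ) : ℂ))
  rw [ofReal_chainSum_ratCast] at h2
  have h3 : (fun i : Fin n => (((0 : Fin n → ℝ) i : ℝ) : ℂ)) = 0 := by ext; simp
  rw [h3, MvPolynomial.eval_zero, MvPolynomial.constantCoeff_eq, MvPolynomial.coeff_map] at h2
  have h4 : ((((chainSumPoly n ψ d).coeff 0 : ℚ) : ℝ) : ℂ) =
      ((chainSum (fun i => (ψ i : ℝ)) d (0 : Fin n → ℝ) : ℝ) : ℂ) := by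
    rw [← h2]; simp
  have h5 := Complex.ofReal_injective h4
  rw [← h5] at h
  exact_mod_cast h

lemma hasRationalForm_sectorDensity {𝒱 : Submodule ℚ ℂ} (m : ℕ) (he : ∀ j, e j ≤ n)
    (hφ : ∀ j i, e j ≤ i → i ≤ n → 0 < φ j i)
    (hw : ∀ t ∈ Set.Icc (0 : Fin n → ℝ) 1, (fun l => chainSum (fun i => (w i l : ℝ)) 0 t) ∈ V)
    {P : MvPolynomial (Fin n) ℂ} (hP : ∀ d, P.coeff d ∈ 𝒱)
    (hEP : ∀ x ∈ V, E (-(m : ℂ), fun i => (x i : ℂ)) =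
      MvPolynomial.eval (fun i => ((x i : ℝ) : ℂ)) P) :
    HasRationalForm 𝒱 (sectorDensity w φ e E) (-m) := by
  refine ⟨∏ j, chainSumPoly n (φ j) (e j) ^ m,
    ∑ d ∈ P.support, MvPolynomial.C (P.coeff d) * MvPolynomial.map (algebraMap ℚ ℂ)
      (MvPolynomial.C |(edgeMatrix w).det| *
        ∏ l, chainSumPoly n (fun i => w i l) 0 ^ d l), ?_, ?_, ?_⟩
  · rw [← MvPolynomial.constantCoeff_eq, map_prod]
    refine Finset.prod_ne_zero_iff.2 fun j _ => ?_
    rw [map_pow, MvPolynomial.constantCoeff_eq]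
    exact pow_ne_zero _ (coeff_zero_chainSumPoly_pos (he j) (hφ j)).ne'
  · intro d
    rw [MvPolynomial.coeff_sum]
    refine Submodule.sum_mem _ fun d' _ => MvPolynomial.coeff_mul_map_mem (fun d'' => ?_) _ d
    classical
    rw [MvPolynomial.coeff_C]
    split_ifs
    · exact hP d'
    · exact 𝒱.zero_mem
  · intro t ht
    have hx := hEP _ (hw t ht)
    have hpos : ∀ j, chainSum (fun i => (φ j i : ℂ)) (e j) (fun i => (t i : ℂ)) ≠ 0 := by
      intro j
      rw [ofReal_chainSum_ratCast]
      exact_mod_cast (chainSum_ratCast_pos (he j) (hφ j) ht).ne'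
    have hcancel : (∏ j, chainSum (fun i => (φ j i : ℂ)) (e j) (fun i => (t i : ℂ)) ^ (-m : ℂ)) *
        ∏ j, chainSum (fun i => (φ j i : ℂ)) (e j) (fun i => (t i : ℂ)) ^ m = 1 := by
      rw [← Finset.prod_mul_distrib]
      refine Finset.prod_eq_one fun j _ => ?_
      rw [Complex.cpow_neg, Complex.cpow_natCast]
      exact inv_mul_cancel₀ (pow_ne_zero _ (hpos j))
    simp only [map_prod, map_pow, eval_map_chainSumPoly, map_sum, map_mul]
    rw [sectorDensity]
    simp only [ofReal_chainSum_ratCast] at hx hcancel ⊢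
    rw [hx, MvPolynomial.eval_eq']
    have hrw : ∀ a b c d : ℂ, b * d = 1 → a * b * c * d = a * c := fun a b c d h => by
      linear_combination a * c * h
    rw [hrw _ _ _ _ hcancel, Finset.mul_sum]
    refine Finset.sum_congr rfl fun d _ => ?_
    simp only [MvPolynomial.map_C, MvPolynomial.eval_C, eq_ratCast]
    ring

lemma prod_ofReal_cpow {ι : Type*} (S : Finset ι) {x : ι → ℝ} (hx : ∀ i ∈ S, 0 ≤ x i) (s : ℂ) :
    ((∏ i ∈ S, x i : ℝ) : ℂ) ^ s = ∏ i ∈ S, (x i : ℂ) ^ s := by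
  classical
  induction S using Finset.induction_on with
  | empty => simp
  | insert a S ha ih =>
    rw [Finset.prod_insert ha, Finset.prod_insert ha, Complex.ofReal_mul,
      Complex.mul_cpow_ofReal_nonneg (hx a (by simp))
        (Finset.prod_nonneg fun i hi => hx i (by simp [hi])),
      ih fun i hi => hx i (by simp [hi])]

lemma smul_eq_cubeIntegrand (he : ∀ j, e j ≤ n) (hzero : ∀ j, ∀ i < e j, φ j i = 0)
    (hφ : ∀ j i, e j ≤ i → i ≤ n → 0 < φ j i) {t : Fin n → ℝ} (ht : ∀ i, t i ∈ Set.Ioc 0 1)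
    (s : ℂ) :
    (((|(edgeMatrix w).det| : ℚ) : ℝ) * ∏ i, t i ^ (n - 1 - (i : ℕ)) : ℝ) •
      (((∏ j, chainSum (fun i => (φ j i : ℝ)) 0 t : ℝ) : ℂ) ^ s *
        E (s, fun l => ((chainSum (fun i => (w i l : ℝ)) 0 t : ℝ) : ℂ))) =
    cubeIntegrand (fun i => (Finset.univ.filter fun j => (i : ℕ) < e j).card)
      (fun i => n - 1 - (i : ℕ)) (sectorDensity w φ e E) s t := by
  have htI : t ∈ Set.Icc (0 : Fin n → ℝ) 1 :=
    ⟨fun i => (ht i).1.le, fun i => (ht i).2⟩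
  have hu : ∀ j ∈ Finset.univ, 0 ≤ chainSum (fun i => (φ j i : ℝ)) (e j) t := fun j _ =>
    (chainSum_ratCast_pos (he j) (hφ j) htI).le
  have hprod : (∏ j, chainSum (fun i => (φ j i : ℝ)) 0 t) =
      (∏ i, t i ^ (Finset.univ.filter fun j => (i : ℕ) < e j).card) *
        ∏ j, chainSum (fun i => (φ j i : ℝ)) (e j) t := by
    have h1 : ∀ j, chainSum (fun i => (φ j i : ℝ)) 0 t =
        chainProd t 0 (e j) * chainSum (fun i => (φ j i : ℝ)) (e j) t := fun j =>
      chainSum_zero_eq_mul (he j) (fun i hi => by simp [hzero j i hi]) t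
    simp only [h1, Finset.prod_mul_distrib, chainProd_eq_prod t (he _)]
    congr 1
    rw [Finset.prod_comm]
    refine Finset.prod_congr rfl fun i _ => ?_
    rw [Finset.prod_ite]
    simp
  have hpow : ∀ i : Fin n, (t i : ℂ) ^ (((Finset.univ.filter fun j => (i : ℕ) < e j).card : ℂ) * s +
      ((n - 1 - (i : ℕ) : ℕ) : ℂ)) =
      ((t i ^ (Finset.univ.filter fun j => (i : ℕ) < e j).card : ℝ) : ℂ) ^ s *
        (t i : ℂ) ^ (n - 1 - (i : ℕ)) := by
    intro i
    have hne : (t i : ℂ) ≠ 0 := by exact_mod_cast (ht i).1.ne'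
    rw [Complex.cpow_add _ _ hne, Complex.cpow_natCast]
    congr 1
    generalize (Finset.univ.filter fun j => (i : ℕ) < e j).card = a
    induction a with
    | zero => simp
    | succ a ih =>
      rw [pow_succ, Complex.ofReal_mul, Complex.mul_cpow_ofReal_nonneg
        (pow_nonneg (ht i).1.le _) (ht i).1.le, ← ih, Nat.cast_succ, add_mul, one_mul,
        Complex.cpow_add _ _ hne]
  rw [cubeIntegrand, sectorDensity]
  simp only [hpow, Finset.prod_mul_distrib, ofReal_chainSum_ratCast]
  rw [hprod, Complex.ofReal_mul, Complex.mul_cpow_ofReal_nonneg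
    (Finset.prod_nonneg fun i _ => pow_nonneg (ht i).1.le _) (Finset.prod_nonneg hu),
    prod_ofReal_cpow _ (fun i _ => pow_nonneg (ht i).1.le _), prod_ofReal_cpow _ hu]
  simp only [Complex.real_smul, Complex.ofReal_mul, Complex.ofReal_prod, Complex.ofReal_pow,
    Complex.ofReal_ratCast]
  ring

end SectorDensity

section RationalSimplex

variable {n : ℕ}

lemma ratCast_sectorVertex (v : Fin (n + 1) → Fin n → ℚ) (σ : Equiv.Perm (Fin (n + 1))) (i : ℕ)
    (l : Fin n) :
    ((sectorVertex v σ i l : ℚ) : ℝ) = sectorVertex (fun p l => (v p l : ℝ)) σ i l := by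
  simpa [sectorVertex] using map_prefixAverage (algebraMap ℚ ℝ) (fun p => v (σ p) l) i

lemma ratCast_abs_det_edgeMatrix (w : ℕ → Fin n → ℚ) :
    ((|(edgeMatrix w).det| : ℚ) : ℝ) = |(edgeMatrix fun i l => (w i l : ℝ)).det| := by
  have h := (algebraMap ℚ ℝ).map_det (edgeMatrix w)
  rw [Rat.cast_abs]
  congr 1
  refine h.trans ?_
  congr 1
  ext i j
  simp [edgeMatrix]

/-- A rational affine function as an affine map. -/
lemma exists_affineMap_eq {f : (Fin n → ℝ) → ℝ} {a : Fin n → ℚ} {c : ℚ}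
    (hf : f = fun x => (c : ℝ) + ∑ i, (a i : ℝ) * x i) :
    ∃ g : (Fin n → ℝ) →ᵃ[ℝ] ℝ, ∀ x, g x = f x := by
  refine ⟨AffineMap.const ℝ _ (c : ℝ) +
    (∑ i, (a i : ℝ) • LinearMap.proj (R := ℝ) (φ := fun _ : Fin n => ℝ) i).toAffineMap, ?_⟩
  intro x
  simp [hf]

end RationalSimplex

/-- If `E(-m, ·)` restricted to `V` is a polynomial whose coefficients lie in
a `ℚ`-subspace `𝒱 ⊆ ℂ`, then the leading Laurent coefficient (`lim (s+m)^n F(s)`) of the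
meromorphic continuation of `∫_V (f₁⋯f_k)^s E(s,x) dx` at `s = -m` lies in `𝒱`. -/
theorem stmt_11 (n k : ℕ) (hn : 1 ≤ n) (m : ℕ) (hm : 0 < m)
    (V : Set (Fin n → ℝ)) (v : Fin (n + 1) → (Fin n → ℝ))
    (hv : AffineIndependent ℝ v) (hV : V = convexHull ℝ (Set.range v))
    (hvQ : ∀ l i, ∃ q : ℚ, v l i = (q : ℝ))
    (f : Fin k → (Fin n → ℝ) → ℝ)
    (hf_aff : ∀ j, ∃ (a : Fin n → ℚ) (c : ℚ),
      f j = fun x => (c : ℝ) + ∑ i, (a i : ℝ) * x i)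
    (hf_pos : ∀ j, ∀ x ∈ interior V, 0 < f j x)
    (E : ℂ × (Fin n → ℂ) → ℂ)
    (U : Set (ℂ × (Fin n → ℂ))) (hU : IsOpen U)
    (hUV : ∀ (s : ℂ) (x : Fin n → ℝ), x ∈ V → (s, fun i => (x i : ℂ)) ∈ U)
    (hE : AnalyticOnNhd ℂ E U)
    (𝒱 : Submodule ℚ ℂ)
    (P : MvPolynomial (Fin n) ℂ)
    (hP : ∀ d : Fin n →₀ ℕ, MvPolynomial.coeff d P ∈ 𝒱)
    (hEP : ∀ x ∈ V, E (-(m : ℂ), fun i => (x i : ℂ)) =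
      MvPolynomial.eval (fun i => ((x i : ℝ) : ℂ)) P) :
    ∃ F : ℂ → ℂ,
      (∀ z : ℂ, MeromorphicAt F z) ∧
      (∀ s : ℂ, 0 < s.re →
        F s = ∫ x in V, (↑(∏ j, f j x) : ℂ) ^ s * E (s, fun i => (x i : ℂ))) ∧
      ∃ L ∈ 𝒱, Tendsto (fun s => (s + (m : ℂ)) ^ n * F s)
        (nhdsWithin (-(m : ℂ)) {-(m : ℂ)}ᶜ) (nhds L) := by
  choose vq hvq using hvQ
  choose a c hac using hf_aff
  choose g hg using fun j => exists_affineMap_eq (hac j)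
  have hspan : affineSpan ℝ (Set.range v) = ⊤ := by
    rw [hv.affineSpan_eq_top_iff_card_eq_finrank_add_one]
    simp
  let b : AffineBasis (Fin (n + 1)) ℝ (Fin n → ℝ) := ⟨v, hv, hspan⟩
  have hb : ⇑b = fun p l => (vq p l : ℝ) := by
    ext p l
    exact hvq p l
  have hVb : V = convexHull ℝ (Set.range b) := hV
  have hgpos : ∀ j, ∀ x ∈ interior (convexHull ℝ (Set.range b)), 0 < g j x := fun j x hx => by
    rw [hg]
    exact hf_pos j x (hVb ▸ hx)
  let y : Fin k → Fin (n + 1) → ℚ := fun j p => c j + ∑ i, a j i * vq p i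
  have hy : ∀ j p, ((y j p : ℚ) : ℝ) = g j (b p) := by
    intro j p
    rw [hg, hac, hb]
    simp [y]
  have hy0 : ∀ j p, 0 ≤ y j p := fun j p => by
    have := (g j).nonneg_of_pos_on_interior_convexHull b (hgpos j) p
    rw [← hy] at this
    exact_mod_cast this
  have hy1 : ∀ j, ∃ p, 0 < y j p := fun j => by
    obtain ⟨p, hp⟩ := (g j).exists_pos_of_pos_on_interior_convexHull b (hgpos j)
    rw [← hy] at hp
    exact ⟨p, by exact_mod_cast hp⟩
  choose e hen he0 hepos using fun (σ : Equiv.Perm (Fin (n + 1))) (j : Fin k) =>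
    exists_forall_lt_prefixAverage_eq_zero (fun p => y j (σ p)) (fun p => hy0 j _) (by
      obtain ⟨p, hp⟩ := hy1 j
      exact ⟨σ.symm p, by simpa using hp⟩)
  let w : Equiv.Perm (Fin (n + 1)) → ℕ → Fin n → ℚ := sectorVertex vq
  let φ : Equiv.Perm (Fin (n + 1)) → Fin k → ℕ → ℚ :=
    fun σ j => prefixAverage fun p => y j (σ p)
  have hw : ∀ σ, (fun i l => ((w σ i l : ℚ) : ℝ)) = sectorVertex b σ := by
    intro σ
    ext i l
    rw [hb]
    exact ratCast_sectorVertex vq σ i l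
  have hwl : ∀ σ (l : Fin n), (fun i => ((w σ i l : ℚ) : ℝ)) = fun i => sectorVertex b σ i l :=
    fun σ l => funext fun i => congrFun (congrFun (hw σ) i) l
  have hφ : ∀ σ j, (fun i => ((φ σ j i : ℚ) : ℝ)) = prefixAverage fun p => g j (b (σ p)) := by
    intro σ j
    ext i
    simp only [← hy]
    simpa using map_prefixAverage (algebraMap ℚ ℝ) (fun p => y j (σ p)) i
  have hwV : ∀ σ, ∀ t ∈ Set.Icc (0 : Fin n → ℝ) 1,
      (fun l => chainSum (fun i => ((w σ i l : ℚ) : ℝ)) 0 t) ∈ V := by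
    intro σ t ht
    simp only [hwl, hVb]
    exact chainSum_sectorVertex_mem b ht σ
  have hG : ∀ σ, AnalyticOnUnitCube (sectorDensity (w σ) (φ σ) (e σ) E) := fun σ =>
    analyticOnUnitCube_sectorDensity (hen σ) (hepos σ) (hwV σ) fun s x hx => hE _ (hUV s x hx)
  obtain ⟨F, hF, hFs, hL⟩ := exists_meromorphicAt_sum_cubeIntegral (𝒱 := 𝒱)
    (fun σ i => (Finset.univ.filter fun j => (i : ℕ) < e σ j).card)
    (fun _ i => n - 1 - (i : ℕ)) (fun σ => sectorDensity (w σ) (φ σ) (e σ) E) hG m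
    fun σ => hasRationalForm_sectorDensity m (hen σ) (hepos σ) (hwV σ) hP hEP
  refine ⟨F, hF, fun s hs => ?_, hL⟩
  rw [hFs s hs, hVb]
  have hInt : ∀ σ, (fun t : Fin n → ℝ =>
      (|(edgeMatrix (sectorVertex b σ)).det| * ∏ i, t i ^ (n - 1 - (i : ℕ)) : ℝ) •
        (((∏ j, f j fun l => chainSum (fun i => sectorVertex b σ i l) 0 t : ℝ) : ℂ) ^ s *
          E (s, fun l => ((chainSum (fun i => sectorVertex b σ i l) 0 t : ℝ) : ℂ))))
      =ᵐ[unitCubeMeasure n]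
      cubeIntegrand (fun i => (Finset.univ.filter fun j => (i : ℕ) < e σ j).card)
        (fun i => n - 1 - (i : ℕ)) (sectorDensity (w σ) (φ σ) (e σ) E) s := by
    intro σ
    filter_upwards [ae_unitCubeMeasure n] with t ht
    rw [← smul_eq_cubeIntegrand (hen σ) (he0 σ) (hepos σ) ht, ratCast_abs_det_edgeMatrix, hw]
    simp only [← hg, AffineMap.map_chainSum_sectorVertex, hwl]
    simp only [← hφ]
    rfl
  rw [setIntegral_convexHull_eq_sum]
  · refine Finset.sum_congr rfl fun σ _ => ?_
    rw [integral_eq_integral_chainSum (bijOn_sector b σ)]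
    exact (integral_congr_ae (hInt σ)).symm
  · intro σ
    rw [integrableOn_iff_integrable_chainSum (bijOn_sector b σ)]
    refine (integrable_cubeIntegrand (hG σ) fun i => ?_).congr (hInt σ).symm
    have : (0 : ℝ) ≤ ((Finset.univ.filter fun j => (i : ℕ) < e σ j).card : ℝ) * s.re := by
      positivity
    have h2 : (0 : ℝ) ≤ ((n - 1 - (i : ℕ) : ℕ) : ℝ) := Nat.cast_nonneg _
    linarith
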